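/- arXiv:1602.02609 — 2 statements merged into one kernel-verified Lean document; each statement's English description precedes it below -/
import Mathlib

section
/- Let n be a positive integer, let K be a compact metric space with dim_T K ≥ n, and let dim_* be one of dim_T, dim_H, dim_P. Then for a generic f ∈ C(K,ℝⁿ) one has sup{dim_* f⁻¹(y) : y ∈ ℝⁿ} = d^n_*(K). -/
open Set Metric Filter Topology TopologicalSpace
open scoped ENNReal NNReal

noncomputable section

universe u

/-- `indBelow n X` means that the small inductive (topological) dimension of `X`
is at most `n - 1`; in particular `indBelow 0 X` means `X = ∅`. -/
def indBelow : ℕ → ∀ (X : Type u) [TopologicalSpace X], Prop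
  | 0, X, _ => IsEmpty X
  | n + 1, X, inst =>
      letI := inst
      ∀ (x : X) (U : Set X), IsOpen U → x ∈ U →
        ∃ V : Set X, IsOpen V ∧ x ∈ V ∧ V ⊆ U ∧ indBelow n ↥(frontier V)

/-- The small inductive (topological) dimension, with values in `EReal`:
`-1` for the empty space and `⊤` if there is no finite bound. -/
def indDim (X : Type u) [TopologicalSpace X] : EReal :=
  sInf {d : EReal | ∃ n : ℕ, indBelow n X ∧ d = (n : EReal) - 1}

variable {X : Type u} [MetricSpace X]

/-- Topological dimension of a subset of a metric space. -/
def tdim (A : Set X) : EReal := indDim ↥A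

open Classical in
/-- Hausdorff dimension of a subset of a metric space,
with the convention `dim ∅ = -1`. -/
def hdim (A : Set X) : EReal := if A = ∅ then -1 else ((dimH A : ℝ≥0∞) : EReal)

/-- A `δ`-packing of `A`: a countable family of pairwise disjoint closed balls
with centers in `A` and radii at most `δ`. -/
def IsPacking (A : Set X) (δ : ℝ≥0) (s : Set (X × ℝ≥0)) : Prop :=
  s.Countable ∧ (∀ p ∈ s, p.1 ∈ A ∧ p.2 ≤ δ) ∧
    s.Pairwise fun p q => Disjoint (closedBall p.1 (p.2 : ℝ)) (closedBall q.1 (q.2 : ℝ))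

/-- The packing pre-measure `P^h_δ(A)`. -/
def packPre (h : ℝ≥0 → ℝ≥0) (A : Set X) (δ : ℝ≥0) : ℝ≥0∞ :=
  ⨆ (s : Set (X × ℝ≥0)) (_ : IsPacking A δ s), ∑' p : s, ((h p.1.2 : ℝ≥0) : ℝ≥0∞)

/-- The packing pre-measure (packing number) `P^h₀(A) = lim_{δ → 0+} P^h_δ(A)`. -/
def packPre0 (h : ℝ≥0 → ℝ≥0) (A : Set X) : ℝ≥0∞ :=
  ⨅ (δ : ℝ≥0) (_ : 0 < δ), packPre h A δ

/-- The `h`-packing measure `𝒫^h(A)`. -/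
def packMeasure (h : ℝ≥0 → ℝ≥0) (A : Set X) : ℝ≥0∞ :=
  ⨅ (c : ℕ → Set X) (_ : A = ⋃ i, c i), ∑' i, packPre0 h (c i)

open Classical in
/-- The packing dimension, with the convention `dim ∅ = -1`. -/
def pdim (A : Set X) : EReal :=
  if A = ∅ then -1
  else max 0 (⨆ (s : ℝ≥0) (_ : packMeasure (fun r => r ^ (s : ℝ)) A = ∞), ((s : ℝ) : EReal))

/-- The restriction of the packing measure `𝒫^h` to `A` is σ-finite. -/
def PackSigmaFiniteOn (h : ℝ≥0 → ℝ≥0) (A : Set X) : Prop :=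
  ∃ c : ℕ → Set X, A ⊆ ⋃ i, c i ∧ ∀ i, packMeasure h (A ∩ c i) < ∞

/-- The generalized Hausdorff measure `ℋ^h(A)` associated to a gauge function `h`. -/
def hMeasure (h : ℝ≥0 → ℝ≥0) (A : Set X) : ℝ≥0∞ :=
  ⨆ (δ : ℝ≥0) (_ : 0 < δ),
    ⨅ (c : ℕ → Set X) (_ : A ⊆ ⋃ i, c i) (_ : ∀ i, EMetric.diam (c i) ≤ (δ : ℝ≥0∞)),
      ∑' i, ((h (EMetric.diam (c i)).toNNReal : ℝ≥0) : ℝ≥0∞)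

/-- `F` is an `F_σ` subset of the subspace `A`. -/
def IsFSigmaIn (F A : Set X) : Prop :=
  ∃ C : ℕ → Set X, (∀ i, IsClosed (C i)) ∧ F = ⋃ i, C i ∩ A

/-- `d^n_*(A) = inf {dim_*(A ∖ F) : F ⊆ A is F_σ in A and dim_T F ≤ n - 1}`. -/
def dStar (dim : Set X → EReal) (n : ℕ) (A : Set X) : EReal :=
  sInf {d : EReal |
    ∃ F : Set X, IsFSigmaIn F A ∧ tdim F ≤ (n : EReal) - 1 ∧ d = dim (A \ F)}

end

universe u

section ZeroDimensional

variable {X : Type u} [MetricSpace X]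

/-- A subset of a metric space is zero-dimensional (or empty): each of its points has arbitrarily
small relatively clopen neighbourhoods. -/
def IsZeroDim (Z : Set X) : Prop :=
  ∀ x ∈ Z, ∀ U : Set X, IsOpen U → x ∈ U →
    ∃ V W : Set X, IsOpen V ∧ IsOpen W ∧ x ∈ V ∧ Z ⊆ V ∪ W ∧ Z ∩ V ∩ W = ∅ ∧ Z ∩ V ⊆ U

theorem IsZeroDim.mono {Z Z' : Set X} (h : IsZeroDim Z) (hZ : Z' ⊆ Z) : IsZeroDim Z' := by
  intro x hx U hU hxU
  obtain ⟨V, W, hV, hW, hxV, hc, hd, hs⟩ := h x (hZ hx) U hU hxU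
  refine ⟨V, W, hV, hW, hxV, hZ.trans hc, ?_, fun y hy => hs ⟨hZ hy.1, hy.2⟩⟩
  exact eq_empty_of_subset_empty fun y hy => hd.subset ⟨⟨hZ hy.1.1, hy.1.2⟩, hy.2⟩

/-- For a zero-dimensional subset, the clopen splitting can be extended to disjoint open sets of
the ambient space. -/
theorem IsZeroDim.exists_disjoint {Z : Set X} (h : IsZeroDim Z) {x : X} (hx : x ∈ Z) {U : Set X}
    (hU : IsOpen U) (hxU : x ∈ U) :
    ∃ V W : Set X, IsOpen V ∧ IsOpen W ∧ x ∈ V ∧ Z ⊆ V ∪ W ∧ Disjoint V W ∧ V ⊆ U := by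
  obtain ⟨V, W, hV, hW, hxV, hc, hd, hs⟩ := h x hx U hU hxU
  have h1 : Disjoint (closure (Z ∩ V)) (Z ∩ W) := by
    have : Disjoint (Z ∩ V) W := disjoint_iff_inter_eq_empty.2 hd
    exact (this.closure_left hW).mono_right inter_subset_right
  have h2 : Disjoint (Z ∩ V) (closure (Z ∩ W)) := by
    have : Disjoint V (Z ∩ W) := by
      rw [disjoint_iff_inter_eq_empty, ← hd]
      ext y; simp only [mem_inter_iff]; tauto
    exact (this.closure_right hV).mono_left inter_subset_right
  obtain ⟨V', W', hV', hW', hVV, hWW, hdd⟩ :=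
    separatedNhds_iff_disjoint.2 (CompletelyNormalSpace.completely_normal h1 h2)
  refine ⟨V' ∩ U, W', hV'.inter hU, hW', ⟨hVV ⟨hx, hxV⟩, hxU⟩, ?_,
    hdd.mono_left inter_subset_left, inter_subset_right⟩
  intro y hy
  rcases hc hy with h | h
  · exact Or.inl ⟨hVV ⟨hy, h⟩, hs ⟨hy, h⟩⟩
  · exact Or.inr (hWW ⟨hy, h⟩)

/-- Every open cover of a zero-dimensional set has a countable disjoint open refinement. -/
theorem IsZeroDim.exists_refinement [SecondCountableTopology X] {Z : Set X} (h : IsZeroDim Z)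
    (O : Set (Set X)) (hO : ∀ U ∈ O, IsOpen U) (hZ : Z ⊆ ⋃₀ O) :
    ∃ D : ℕ → Set X, (∀ i, IsOpen (D i)) ∧ Pairwise (Function.onFun Disjoint D) ∧ Z ⊆ ⋃ i, D i ∧
      ∀ i, D i = ∅ ∨ ∃ U ∈ O, D i ⊆ U := by
  have h1 : ∀ x : X, ∃ V W : Set X, IsOpen V ∧ IsOpen W ∧ (x ∈ Z → x ∈ V) ∧ Z ⊆ V ∪ W ∧
      Disjoint V W ∧ (V = ∅ ∨ ∃ U ∈ O, V ⊆ U) := by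
    intro x
    by_cases hx : x ∈ Z
    · obtain ⟨U, hUO, hxU⟩ := hZ hx
      obtain ⟨V, W, hV, hW, hxV, hc, hd, hs⟩ := h.exists_disjoint hx (hO U hUO) hxU
      exact ⟨V, W, hV, hW, fun _ => hxV, hc, hd, Or.inr ⟨U, hUO, hs⟩⟩
    · exact ⟨∅, univ, isOpen_empty, isOpen_univ, fun h => (hx h).elim, by simp, by simp,
        Or.inl rfl⟩
  choose V W hV hW hxV hc hd hs using h1
  obtain ⟨T, hTc, hT⟩ := isOpen_iUnion_countable V hV
  rcases T.eq_empty_or_nonempty with rfl | hne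
  · refine ⟨fun _ => ∅, by simp, ?_, ?_, by simp⟩
    · intro i j _; simp [Function.onFun]
    · intro x hx
      have : x ∈ ⋃ i, V i := mem_iUnion.2 ⟨x, hxV x hx⟩
      rw [← hT] at this; simp at this
  obtain ⟨e, rfl⟩ := hTc.exists_eq_range hne
  refine ⟨fun i => V (e i) ∩ ⋂ j ∈ Finset.range i, W (e j), ?_, ?_, ?_, ?_⟩
  · intro i
    exact (hV _).inter (isOpen_biInter_finset fun j _ => hW _)
  · have key : ∀ i j, i < j → Disjoint (V (e i) ∩ ⋂ k ∈ Finset.range i, W (e k))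
        (V (e j) ∩ ⋂ k ∈ Finset.range j, W (e k)) := by
      intro i j hij
      rw [disjoint_left]
      intro y hy hy'
      have := mem_iInter₂.1 hy'.2 i (Finset.mem_range.2 hij)
      exact disjoint_left.1 (hd (e i)) hy.1 this
    intro i j hij
    rcases lt_or_gt_of_ne hij with h | h
    · exact key i j h
    · exact (key j i h).symm
  · intro x hx
    have : x ∈ ⋃ i, V i := mem_iUnion.2 ⟨x, hxV x hx⟩
    rw [← hT] at this
    have hex : ∃ i, x ∈ V (e i) := by simpa using this
    classical
    refine mem_iUnion.2 ⟨Nat.find hex, Nat.find_spec hex, mem_iInter₂.2 fun j hj => ?_⟩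
    have := Nat.find_min hex (Finset.mem_range.1 hj)
    exact (hc (e j) hx).resolve_left this
  · intro i
    rcases hs (e i) with h | ⟨U, hU, hs⟩
    · left; simp [h]
    · exact Or.inr ⟨U, hU, inter_subset_left.trans hs⟩

/-- In a normal space, disjoint closed sets have closed neighbourhoods that are disjoint. -/
theorem exists_closed_nhds_disjoint {A B : Set X} (hA : IsClosed A) (hB : IsClosed B)
    (h : Disjoint A B) : ∃ A' B' : Set X, IsClosed A' ∧ IsClosed B' ∧ Disjoint A' B' ∧
      A ⊆ interior A' ∧ B ⊆ interior B' := by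
  obtain ⟨U, hU, hAU, hUB⟩ := normal_exists_closure_subset hA hB.isOpen_compl
    (subset_compl_iff_disjoint_right.2 h)
  obtain ⟨V, hV, hBV, hVU⟩ := normal_exists_closure_subset hB
    (isClosed_closure (s := U)).isOpen_compl (subset_compl_comm.1 hUB)
  exact ⟨closure U, closure V, isClosed_closure, isClosed_closure,
    (disjoint_left.2 fun y hy hy' => hVU hy' hy),
    hAU.trans (interior_maximal subset_closure hU), hBV.trans (interior_maximal subset_closure hV)⟩

/-- Disjoint closed sets can be separated by open sets covering a given zero-dimensional set. -/
theorem IsZeroDim.exists_partition [SecondCountableTopology X] {Z : Set X} (h : IsZeroDim Z)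
    {A B : Set X} (hA : IsClosed A) (hB : IsClosed B) (hAB : Disjoint A B) :
    ∃ V W : Set X, IsOpen V ∧ IsOpen W ∧ Disjoint V W ∧ A ⊆ V ∧ B ⊆ W ∧ Z ⊆ V ∪ W := by
  obtain ⟨A', B', hA', hB', hd, hAA, hBB⟩ := exists_closed_nhds_disjoint hA hB hAB
  obtain ⟨D, hD, hDd, hZ, hDO⟩ := h.exists_refinement {A'ᶜ, B'ᶜ}
    (by rintro U (rfl | rfl); exacts [hA'.isOpen_compl, hB'.isOpen_compl])
    (by
      intro x _
      by_cases hx : x ∈ A'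
      · exact ⟨B'ᶜ, by simp, fun hx' => disjoint_left.1 hd hx hx'⟩
      · exact ⟨A'ᶜ, by simp, hx⟩)
  have hDB : ∀ i, ¬ Disjoint (D i) A' → Disjoint (D i) B' := by
    intro i hi
    rcases hDO i with h | ⟨U, rfl | rfl, hs⟩
    · simp [h]
    · exact (hi (subset_compl_iff_disjoint_right.1 hs)).elim
    · exact subset_compl_iff_disjoint_right.1 hs
  refine ⟨interior A' ∪ ⋃ (i) (_ : ¬ Disjoint (D i) A'), D i,
    interior B' ∪ ⋃ (i) (_ : Disjoint (D i) A'), D i,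
    isOpen_interior.union (isOpen_iUnion fun i => isOpen_iUnion fun _ => hD i),
    isOpen_interior.union (isOpen_iUnion fun i => isOpen_iUnion fun _ => hD i), ?_,
    hAA.trans subset_union_left, hBB.trans subset_union_left, ?_⟩
  · rw [disjoint_left]
    rintro y (hy | hy) (hy' | hy')
    · exact disjoint_left.1 hd (interior_subset hy) (interior_subset hy')
    · simp only [mem_iUnion] at hy'
      obtain ⟨i, hi, hyi⟩ := hy'
      exact disjoint_left.1 hi hyi (interior_subset hy)
    · simp only [mem_iUnion] at hy
      obtain ⟨i, hi, hyi⟩ := hy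
      exact disjoint_left.1 (hDB i hi) hyi (interior_subset hy')
    · simp only [mem_iUnion] at hy hy'
      obtain ⟨i, hi, hyi⟩ := hy
      obtain ⟨j, hj, hyj⟩ := hy'
      have hij : i ≠ j := by rintro rfl; exact hi hj
      exact disjoint_left.1 (hDd hij) hyi hyj
  · intro x hx
    obtain ⟨i, hi⟩ := mem_iUnion.1 (hZ hx)
    by_cases hd' : Disjoint (D i) A'
    · exact Or.inr (Or.inr (mem_iUnion₂.2 ⟨i, hd', hi⟩))
    · exact Or.inl (Or.inr (mem_iUnion₂.2 ⟨i, hd', hi⟩))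

theorem isZeroDim_image_val {Y : Set X} {Z : Set Y} :
    IsZeroDim (Subtype.val '' Z) ↔ IsZeroDim Z := by
  constructor
  · intro h x hx U hU hxU
    obtain ⟨U', hU', rfl⟩ := isOpen_induced_iff.1 hU
    obtain ⟨V, W, hV, hW, hxV, hc, hd, hs⟩ := h x (mem_image_of_mem _ hx) U' hU' hxU
    refine ⟨Subtype.val ⁻¹' V, Subtype.val ⁻¹' W, hV.preimage continuous_subtype_val,
      hW.preimage continuous_subtype_val, hxV, fun y hy => hc (mem_image_of_mem _ hy), ?_,
      fun y hy => hs ⟨mem_image_of_mem _ hy.1, hy.2⟩⟩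
    exact eq_empty_of_subset_empty fun y hy =>
      hd.subset ⟨⟨mem_image_of_mem _ hy.1.1, hy.1.2⟩, hy.2⟩
  · rintro h _ ⟨x, hx, rfl⟩ U hU hxU
    obtain ⟨V, W, hV, hW, hxV, hc, hd, hs⟩ :=
      h x hx (Subtype.val ⁻¹' U) (hU.preimage continuous_subtype_val) hxU
    obtain ⟨V', hV', rfl⟩ := isOpen_induced_iff.1 hV
    obtain ⟨W', hW', rfl⟩ := isOpen_induced_iff.1 hW
    refine ⟨V', W', hV', hW', hxV, ?_, ?_, ?_⟩
    · rintro _ ⟨y, hy, rfl⟩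
      exact hc hy
    · refine eq_empty_of_subset_empty ?_
      rintro _ ⟨⟨⟨y, hy, rfl⟩, h1⟩, h2⟩
      exact hd.subset (show y ∈ _ from ⟨⟨hy, h1⟩, h2⟩)
    · rintro _ ⟨⟨y, hy, rfl⟩, h1⟩
      exact hs ⟨hy, h1⟩

/-- One step of the construction for the sum theorem: enlarge a pair of disjoint closed sets so
that they cover a given closed zero-dimensional set. -/
theorem IsZeroDim.exists_enlarge [SecondCountableTopology X] {C : Set X} (h : IsZeroDim C)
    (hC : IsClosed C) {A B : Set X} (hA : IsClosed A) (hB : IsClosed B) (hAB : Disjoint A B) :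
    ∃ A' B' : Set X, IsClosed A' ∧ IsClosed B' ∧ Disjoint A' B' ∧ A ⊆ interior A' ∧
      B ⊆ interior B' ∧ C ⊆ interior A' ∪ interior B' := by
  obtain ⟨P, Q, hP, hQ, hPQ, hAP, hBQ, hc⟩ := h.exists_partition hA hB hAB
  have hd : Disjoint (A ∪ C \ Q) (B ∪ C \ P) := by
    rw [disjoint_left]
    rintro y (hy | hy) (hy' | hy')
    · exact disjoint_left.1 hAB hy hy'
    · exact hy'.2 (hAP hy)
    · exact hy.2 (hBQ hy')
    · rcases hc hy.1 with h | h
      exacts [hy'.2 h, hy.2 h]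
  obtain ⟨A', B', hA', hB', hd', hAA, hBB⟩ := exists_closed_nhds_disjoint
    (hA.union (hC.sdiff hQ)) (hB.union (hC.sdiff hP)) hd
  refine ⟨A', B', hA', hB', hd', subset_union_left.trans hAA, subset_union_left.trans hBB, ?_⟩
  intro x hx
  by_cases hxQ : x ∈ Q
  · exact Or.inr (hBB (Or.inr ⟨hx, fun hxP => disjoint_left.1 hPQ hxP hxQ⟩))
  · exact Or.inl (hAA (Or.inr ⟨hx, hxQ⟩))

/-- The countable closed sum theorem in dimension zero, for a cover of the whole space. -/
theorem isZeroDim_univ_of_closed_cover [SecondCountableTopology X] {C : ℕ → Set X}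
    (hC : ∀ i, IsClosed (C i)) (hz : ∀ i, IsZeroDim (C i)) (hu : ⋃ i, C i = univ) :
    IsZeroDim (univ : Set X) := by
  intro x _ U hU hxU
  let S := {p : Set X × Set X // IsClosed p.1 ∧ IsClosed p.2 ∧ Disjoint p.1 p.2}
  have step : ∀ (i : ℕ) (p : S), ∃ q : S, p.1.1 ⊆ interior q.1.1 ∧ p.1.2 ⊆ interior q.1.2 ∧
      C i ⊆ interior q.1.1 ∪ interior q.1.2 := by
    rintro i ⟨⟨A, B⟩, hA, hB, hAB⟩
    obtain ⟨A', B', h1, h2, h3, h4, h5, h6⟩ := (hz i).exists_enlarge (hC i) hA hB hAB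
    exact ⟨⟨⟨A', B'⟩, h1, h2, h3⟩, h4, h5, h6⟩
  choose next hn1 hn2 hn3 using step
  let p0 : S := ⟨⟨{x}, Uᶜ⟩, isClosed_singleton, hU.isClosed_compl, by simpa using hxU⟩
  let p : ℕ → S := fun k => Nat.rec p0 (fun i q => next i q) k
  have hp : ∀ i, p (i + 1) = next i (p i) := fun i => rfl
  have m1 : Monotone fun i => (p i).1.1 := monotone_nat_of_le_succ fun i => by
    rw [hp]; exact (hn1 i (p i)).trans interior_subset
  have m2 : Monotone fun i => (p i).1.2 := monotone_nat_of_le_succ fun i => by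
    rw [hp]; exact (hn2 i (p i)).trans interior_subset
  have hdis : Disjoint (⋃ i, interior (p i).1.1) (⋃ i, interior (p i).1.2) := by
    rw [disjoint_left]
    intro y hy hy'
    obtain ⟨i, hi⟩ := mem_iUnion.1 hy
    obtain ⟨j, hj⟩ := mem_iUnion.1 hy'
    exact disjoint_left.1 (p (max i j)).2.2.2 (m1 (le_max_left i j) (interior_subset hi))
      (m2 (le_max_right i j) (interior_subset hj))
  refine ⟨⋃ i, interior (p i).1.1, ⋃ i, interior (p i).1.2,
    isOpen_iUnion fun _ => isOpen_interior, isOpen_iUnion fun _ => isOpen_interior, ?_, ?_, ?_, ?_⟩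
  · refine mem_iUnion.2 ⟨1, ?_⟩
    exact hn1 0 (p 0) (mem_singleton x)
  · intro y _
    obtain ⟨i, hi⟩ := mem_iUnion.1 (hu.symm.subset (mem_univ y))
    rcases hn3 i (p i) hi with h | h
    · exact Or.inl (mem_iUnion.2 ⟨i + 1, h⟩)
    · exact Or.inr (mem_iUnion.2 ⟨i + 1, h⟩)
  · rw [univ_inter]; exact disjoint_iff_inter_eq_empty.1 hdis
  · rw [univ_inter]
    intro y hy
    by_contra hyU
    refine disjoint_left.1 hdis hy (mem_iUnion.2 ⟨1, hn2 0 (p 0) hyU⟩)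

/-- The countable closed sum theorem in dimension zero. -/
theorem IsZeroDim.of_closed_cover [SecondCountableTopology X] {Z : Set X} {C : ℕ → Set X}
    (hC : ∀ i, IsClosed (C i)) (hz : ∀ i, IsZeroDim (Z ∩ C i)) (hu : Z ⊆ ⋃ i, C i) :
    IsZeroDim Z := by
  have : IsZeroDim (univ : Set Z) := by
    refine isZeroDim_univ_of_closed_cover (C := fun i => Subtype.val ⁻¹' C i)
      (fun i => (hC i).preimage continuous_subtype_val) (fun i => ?_) ?_
    · rw [← isZeroDim_image_val, Subtype.image_preimage_coe]; exact hz i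
    · rw [← preimage_iUnion]; exact eq_univ_of_forall fun x => hu x.2
  rw [← isZeroDim_image_val] at this
  simpa using this

theorem IsZeroDim.of_closed_cover' [SecondCountableTopology X] {ι : Type*} [Countable ι]
    {Z : Set X} {C : ι → Set X}
    (hC : ∀ i, IsClosed (C i)) (hz : ∀ i, IsZeroDim (Z ∩ C i)) (hu : Z ⊆ ⋃ i, C i) :
    IsZeroDim Z := by
  rcases isEmpty_or_nonempty ι with h | h
  · intro x hx; simpa using hu hx
  · obtain ⟨e, he⟩ := exists_surjective_nat ι
    exact IsZeroDim.of_closed_cover (fun i => hC (e i)) (fun i => hz (e i))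
      (hu.trans (he.iUnion_comp C).symm.subset)

/-- A zero-dimensional set is contained in a zero-dimensional `G_δ` set. -/
theorem IsZeroDim.exists_isGδ [SecondCountableTopology X] {Z : Set X} (h : IsZeroDim Z) :
    ∃ G : Set X, IsGδ G ∧ Z ⊆ G ∧ IsZeroDim G := by
  have h1 : ∀ m : ℕ, ∃ D : ℕ → Set X, (∀ i, IsOpen (D i)) ∧
      Pairwise (Function.onFun Disjoint D) ∧ Z ⊆ ⋃ i, D i ∧
      ∀ i, D i = ∅ ∨ ∃ U ∈ range (fun x : X => ball x (1 / ((m : ℝ) + 1))), D i ⊆ U := by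
    intro m
    refine h.exists_refinement _ (by rintro _ ⟨x, rfl⟩; exact isOpen_ball) ?_
    intro x _
    exact ⟨_, ⟨x, rfl⟩, mem_ball_self (by positivity)⟩
  choose D hD hDd hZ hDs using h1
  refine ⟨⋂ m, ⋃ i, D m i, .iInter_of_isOpen fun m => isOpen_iUnion (hD m), subset_iInter hZ, ?_⟩
  intro x hx U hU hxU
  obtain ⟨ε, hε, hεU⟩ := Metric.isOpen_iff.1 hU x hxU
  obtain ⟨m, hm⟩ := exists_nat_one_div_lt (half_pos hε)
  obtain ⟨i, hi⟩ := mem_iUnion.1 (mem_iInter.1 hx m)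
  refine ⟨D m i, ⋃ (j) (_ : j ≠ i), D m j, hD m i,
    isOpen_iUnion fun j => isOpen_iUnion fun _ => hD m j, hi, ?_, ?_, ?_⟩
  · intro y hy
    obtain ⟨j, hj⟩ := mem_iUnion.1 (mem_iInter.1 hy m)
    by_cases hji : j = i
    · exact Or.inl (hji ▸ hj)
    · exact Or.inr (mem_iUnion₂.2 ⟨j, hji, hj⟩)
  · refine eq_empty_of_subset_empty fun y hy => ?_
    obtain ⟨j, hji, hj⟩ := mem_iUnion₂.1 hy.2
    exact disjoint_left.1 (hDd m hji) hj hy.1.2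
  · intro y hy
    rcases hDs m i with h | ⟨_, ⟨c, rfl⟩, hc⟩
    · rw [h] at hi; exact hi.elim
    · apply hεU
      have h1 := mem_ball.1 (hc hi)
      have h2 := mem_ball.1 (hc hy.2)
      rw [mem_ball]
      linarith [dist_triangle_right y x c]

end ZeroDimensional

section CoveringByZeroDimensional

variable {X : Type u} [MetricSpace X]

/-- `A` has dimension less than `n`: it is covered by `n` zero-dimensional sets. -/
def DimLT (n : ℕ) (A : Set X) : Prop :=
  ∃ Z : Fin n → Set X, (∀ i, IsZeroDim (Z i)) ∧ A ⊆ ⋃ i, Z i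

theorem DimLT.mono {n : ℕ} {A B : Set X} (h : DimLT n B) (hAB : A ⊆ B) : DimLT n A := by
  obtain ⟨Z, hZ, hB⟩ := h
  exact ⟨Z, hZ, hAB.trans hB⟩

theorem IsZeroDim.empty : IsZeroDim (∅ : Set X) := fun _ hx => hx.elim

theorem IsZeroDim.singleton (x : X) : IsZeroDim ({x} : Set X) := by
  rintro y rfl U hU hyU
  exact ⟨univ, ∅, isOpen_univ, isOpen_empty, mem_univ _, by simp, by simp, by simpa using hyU⟩

theorem DimLT.mono_nat {n m : ℕ} (hnm : n ≤ m) {A : Set X} (h : DimLT n A) : DimLT m A := by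
  obtain ⟨Z, hZ, hB⟩ := h
  refine ⟨fun i => if hi : (i : ℕ) < n then Z ⟨i, hi⟩ else ∅, fun i => ?_, fun x hx => ?_⟩
  · dsimp only
    split_ifs
    exacts [hZ _, IsZeroDim.empty]
  · obtain ⟨i, hi⟩ := mem_iUnion.1 (hB hx)
    refine mem_iUnion.2 ⟨⟨i, i.2.trans_le hnm⟩, ?_⟩
    simpa using hi

theorem dimLT_image_val {n : ℕ} {Y : Set X} {A : Set Y} :
    DimLT n (Subtype.val '' A) ↔ DimLT n A := by
  constructor
  · rintro ⟨Z, hZ, hA⟩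
    refine ⟨fun i => Subtype.val ⁻¹' Z i, fun i => ?_, fun x hx => ?_⟩
    · rw [← isZeroDim_image_val]
      exact (hZ i).mono (image_preimage_subset _ _)
    · obtain ⟨i, hi⟩ := mem_iUnion.1 (hA (mem_image_of_mem _ hx))
      exact mem_iUnion.2 ⟨i, hi⟩
  · rintro ⟨Z, hZ, hA⟩
    refine ⟨fun i => Subtype.val '' Z i, fun i => isZeroDim_image_val.2 (hZ i), ?_⟩
    rw [← image_iUnion]
    exact image_mono hA

theorem dimLT_univ_subtype {n : ℕ} {A : Set X} : DimLT n (univ : Set A) ↔ DimLT n A := by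
  rw [← dimLT_image_val, image_univ, Subtype.range_coe]

variable [SecondCountableTopology X]

/-- The countable closed sum theorem. -/
theorem DimLT.of_closed_cover_nat {n : ℕ} {A : Set X} {C : ℕ → Set X} (hC : ∀ i, IsClosed (C i))
    (h : ∀ i, DimLT n (A ∩ C i)) (hu : A ⊆ ⋃ i, C i) : DimLT n A := by
  choose Y hY hAY using h
  have hO : ∀ i : ℕ, IsOpen (⋃ j ∈ Finset.range i, C j)ᶜ := fun i =>
    (isClosed_biUnion_finset fun j _ => hC j).isOpen_compl
  choose D hDc hDs hDu _ using fun i => (hO i).exists_iUnion_isClosed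
  have hmem : ∀ i x, x ∈ (⋃ j ∈ Finset.range i, C j)ᶜ ↔ ∀ j < i, x ∉ C j := by
    intro i x; simp
  refine ⟨fun k => ⋃ i, Y i k ∩ (A ∩ C i) ∩ (⋃ j ∈ Finset.range i, C j)ᶜ, fun k => ?_, ?_⟩
  · refine IsZeroDim.of_closed_cover' (ι := ℕ × ℕ) (C := fun p => C p.1 ∩ D p.1 p.2)
      (fun p => (hC _).inter (hDc _ _)) ?_ ?_
    · rintro ⟨i, l⟩
      refine (hY i k).mono ?_
      rintro x ⟨hx, hx1, hx2⟩
      obtain ⟨i', ⟨hxY, -, hxC⟩, hx'⟩ := mem_iUnion.1 hx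
      have h2 := (hmem i x).1 (hDs i l hx2)
      have h3 := (hmem i' x).1 hx'
      have : i = i' := by
        rcases lt_trichotomy i i' with h | h | h
        · exact (h3 i h hx1).elim
        · exact h
        · exact (h2 i' h hxC).elim
      exact this ▸ hxY
    · intro x hx
      obtain ⟨i, ⟨-, -, hxC⟩, hx'⟩ := mem_iUnion.1 hx
      rw [← hDu i] at hx'
      obtain ⟨l, hl⟩ := mem_iUnion.1 hx'
      exact mem_iUnion.2 ⟨(i, l), hxC, hl⟩
  · intro x hx
    have hex : ∃ i, x ∈ C i := mem_iUnion.1 (hu hx)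
    classical
    have h1 := Nat.find_spec hex
    obtain ⟨k, hk⟩ := mem_iUnion.1 (hAY (Nat.find hex) ⟨hx, h1⟩)
    exact mem_iUnion.2 ⟨k, mem_iUnion.2 ⟨Nat.find hex, ⟨hk, hx, h1⟩,
      (hmem _ x).2 fun j hj => Nat.find_min hex hj⟩⟩

theorem DimLT.of_closed_cover {ι : Type*} [Countable ι] {n : ℕ} {A : Set X} {C : ι → Set X}
    (hC : ∀ i, IsClosed (C i)) (h : ∀ i, DimLT n (A ∩ C i)) (hu : A ⊆ ⋃ i, C i) : DimLT n A := by
  rcases isEmpty_or_nonempty ι with hι | hι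
  · exact ⟨fun _ => ∅, fun _ => IsZeroDim.empty, fun x hx => by simpa using hu hx⟩
  · obtain ⟨e, he⟩ := exists_surjective_nat ι
    exact DimLT.of_closed_cover_nat (fun i => hC (e i)) (fun i => h (e i))
      (hu.trans (he.iUnion_comp C).symm.subset)

theorem DimLT.iUnion_closed {ι : Type*} [Countable ι] {n : ℕ} {C : ι → Set X}
    (hC : ∀ i, IsClosed (C i)) (h : ∀ i, DimLT n (C i)) : DimLT n (⋃ i, C i) :=
  DimLT.of_closed_cover hC (fun i => (h i).mono inter_subset_right) subset_rfl

/-- A set of dimension less than `n` lies in a `G_δ` set of dimension less than `n`. -/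
theorem DimLT.exists_isGδ {n : ℕ} {A : Set X} (h : DimLT n A) :
    ∃ G : Set X, IsGδ G ∧ A ⊆ G ∧ DimLT n G := by
  obtain ⟨Z, hZ, hA⟩ := h
  choose G hG hZG hGz using fun i => (hZ i).exists_isGδ
  exact ⟨⋃ i, G i, .iUnion hG, hA.trans (iUnion_mono hZG), G, hGz, subset_rfl⟩

theorem IsZeroDim.insert {Z : Set X} (h : IsZeroDim Z) (x : X) : IsZeroDim (insert x Z) := by
  have hO : IsOpen ({x}ᶜ : Set X) := isOpen_compl_singleton
  obtain ⟨D, hDc, hDs, hDu, -⟩ := hO.exists_iUnion_isClosed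
  refine IsZeroDim.of_closed_cover' (ι := Option ℕ)
    (C := fun o => Option.casesOn o {x} D) ?_ ?_ ?_
  · rintro (_ | i)
    exacts [isClosed_singleton, hDc i]
  · rintro (_ | i)
    · exact (IsZeroDim.singleton x).mono inter_subset_right
    · refine h.mono ?_
      rintro y ⟨rfl | hy, hy'⟩
      exacts [(hDs i hy' rfl).elim, hy]
  · intro y hy
    by_cases hyx : y = x
    · exact mem_iUnion.2 ⟨none, hyx⟩
    · have : y ∈ ⋃ i, D i := by rw [hDu]; exact hyx
      obtain ⟨i, hi⟩ := mem_iUnion.1 this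
      exact mem_iUnion.2 ⟨some i, hi⟩

theorem DimLT.union_finite {n : ℕ} (hn : 0 < n) {A S : Set X} (h : DimLT n A) (hS : S.Finite) :
    DimLT n (A ∪ S) := by
  induction S, hS using Set.Finite.induction_on with
  | empty => simpa using h
  | @insert a S _ _ ih =>
    obtain ⟨Z, hZ, hA⟩ := ih
    refine ⟨fun i => Insert.insert a (Z i), fun i => (hZ i).insert a, ?_⟩
    rintro x (hx | rfl | hx)
    · obtain ⟨i, hi⟩ := mem_iUnion.1 (hA (Or.inl hx))
      exact mem_iUnion.2 ⟨i, Or.inr hi⟩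
    · exact mem_iUnion.2 ⟨⟨0, hn⟩, Or.inl rfl⟩
    · obtain ⟨i, hi⟩ := mem_iUnion.1 (hA (Or.inr hx))
      exact mem_iUnion.2 ⟨i, Or.inr hi⟩

/-- The decomposition step: a space with a base of open sets whose boundaries have dimension
less than `n` has dimension less than `n + 1`. -/
theorem dimLT_succ_of_frontier {n : ℕ}
    (h : ∀ (x : X) (U : Set X), IsOpen U → x ∈ U →
      ∃ V : Set X, IsOpen V ∧ x ∈ V ∧ V ⊆ U ∧ DimLT n (frontier V)) :
    DimLT (n + 1) (univ : Set X) := by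
  have h1 : ∀ b : countableBasis X, ∃ T : Set (Set X), T.Countable ∧
      T ⊆ {V | IsOpen V ∧ V ⊆ b ∧ DimLT n (frontier V)} ∧
      ⋃₀ T = ⋃₀ {V | IsOpen V ∧ V ⊆ b ∧ DimLT n (frontier V)} :=
    fun b => isOpen_sUnion_countable _ fun V hV => hV.1
  choose T hTc hTs hTu using h1
  have hcount : (⋃ b, T b).Countable := by
    have := (countable_countableBasis X).to_subtype
    exact countable_iUnion hTc
  have := hcount.to_subtype
  have hfr : DimLT n (⋃ V : (⋃ b, T b : Set (Set X)), frontier (V : Set X)) := by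
    refine DimLT.iUnion_closed (fun _ => isClosed_frontier) ?_
    rintro ⟨V, hV⟩
    obtain ⟨b, hb⟩ := mem_iUnion.1 hV
    exact (hTs b hb).2.2
  obtain ⟨Z, hZ, hA⟩ := hfr
  refine ⟨Fin.cons (⋃ V : (⋃ b, T b : Set (Set X)), frontier (V : Set X))ᶜ Z, ?_, ?_⟩
  · intro i
    refine Fin.cases ?_ (fun i => ?_) i
    · rw [Fin.cons_zero]
      intro x hx U hU hxU
      obtain ⟨b, hb, hxb, hbU⟩ := (isBasis_countableBasis X).exists_subset_of_mem_open hxU hU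
      obtain ⟨V, hV, hxV, hVb, hVd⟩ := h x b ((isBasis_countableBasis X).isOpen hb) hxb
      have : x ∈ ⋃₀ T ⟨b, hb⟩ := by
        rw [hTu]; exact ⟨V, ⟨hV, hVb, hVd⟩, hxV⟩
      obtain ⟨V', hV', hxV'⟩ := this
      obtain ⟨ho, hs, -⟩ := hTs _ hV'
      refine ⟨V', (closure V')ᶜ, ho, isClosed_closure.isOpen_compl, hxV', ?_, ?_,
        fun y hy => hbU (hs hy.2)⟩
      · intro y hy
        by_cases hyV : y ∈ V'
        · exact Or.inl hyV
        · refine Or.inr fun hyc => hy ?_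
          refine mem_iUnion.2 ⟨⟨V', mem_iUnion.2 ⟨_, hV'⟩⟩, ?_⟩
          rw [ho.frontier_eq]
          exact ⟨hyc, hyV⟩
      · exact eq_empty_of_subset_empty fun y hy => hy.2 (subset_closure hy.1.2)
    · rw [Fin.cons_succ]; exact hZ i
  · intro x _
    by_cases hx : x ∈ ⋃ V : (⋃ b, T b : Set (Set X)), frontier (V : Set X)
    · obtain ⟨i, hi⟩ := mem_iUnion.1 (hA hx)
      exact mem_iUnion.2 ⟨i.succ, by rwa [Fin.cons_succ]⟩
    · exact mem_iUnion.2 ⟨0, by rwa [Fin.cons_zero]⟩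

theorem indBelow_iff_dimLT (n : ℕ) (X : Type u) [MetricSpace X] [SecondCountableTopology X] :
    indBelow n X ↔ DimLT n (univ : Set X) := by
  induction n generalizing X with
  | zero =>
    constructor
    · intro h
      have : IsEmpty X := h
      exact ⟨Fin.elim0, fun i => i.elim0, fun x => (this.false x).elim⟩
    · rintro ⟨Z, -, h⟩
      exact ⟨fun x => by simpa using h (mem_univ x)⟩
  | succ n ih =>
    constructor
    · intro h
      refine dimLT_succ_of_frontier fun x U hU hxU => ?_
      obtain ⟨V, hV, hxV, hVU, hf⟩ := h x U hU hxU
      exact ⟨V, hV, hxV, hVU, dimLT_univ_subtype.1 ((ih _).1 hf)⟩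
    · rintro ⟨Z, hZ, hA⟩ x U hU hxU
      obtain ⟨V, W, hV, hW, hVW, hxV, hUW, hZVW⟩ := (hZ (Fin.last n)).exists_partition
        (isClosed_singleton (x := x)) hU.isClosed_compl (by simpa using hxU)
      refine ⟨V, hV, hxV rfl, fun y hy => ?_, (ih _).2 (dimLT_univ_subtype.2 ?_)⟩
      · by_contra hyU
        exact disjoint_left.1 hVW hy (hUW hyU)
      · refine ⟨fun i => Z i.castSucc, fun i => hZ _, fun y hy => ?_⟩
        rw [hV.frontier_eq] at hy
        have hyZ : y ∉ Z (Fin.last n) := fun h' => by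
          rcases hZVW h' with h' | h'
          · exact hy.2 h'
          · exact disjoint_left.1 (hVW.closure_left hW) hy.1 h'
        obtain ⟨i, hi⟩ := mem_iUnion.1 (hA (mem_univ y))
        refine Fin.lastCases (fun h => (hyZ h).elim) (fun j hj => mem_iUnion.2 ⟨j, hj⟩) i hi

theorem tdim_le_iff_dimLT {n : ℕ} {A : Set X} : tdim A ≤ (n : EReal) - 1 ↔ DimLT n A := by
  constructor
  · intro h
    have hlt : indDim A < (n : EReal) := by
      refine lt_of_le_of_lt h ?_
      rw [show ((n : EReal) - 1) = (((n : ℝ) - 1 : ℝ) : EReal) by push_cast; rfl,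
        show (n : EReal) = ((n : ℝ) : EReal) from rfl, EReal.coe_lt_coe_iff]
      linarith
    obtain ⟨d, ⟨m, hm, rfl⟩, hd⟩ := sInf_lt_iff.1 hlt
    have : m ≤ n := by
      rw [show ((m : EReal) - 1) = (((m : ℝ) - 1 : ℝ) : EReal) by push_cast; rfl,
        show (n : EReal) = ((n : ℝ) : EReal) from rfl, EReal.coe_lt_coe_iff] at hd
      have : (m : ℝ) < n + 1 := by linarith
      exact_mod_cast Nat.lt_succ_iff.1 (by exact_mod_cast this)
    exact (dimLT_univ_subtype.1 ((indBelow_iff_dimLT m _).1 hm)).mono_nat this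
  · intro h
    exact sInf_le ⟨n, (indBelow_iff_dimLT n _).2 (dimLT_univ_subtype.2 h), rfl⟩

theorem tdim_le_tdim {A B : Set X} (h : ∀ n, DimLT n B → DimLT n A) : tdim A ≤ tdim B := by
  refine le_sInf ?_
  rintro _ ⟨n, hn, rfl⟩
  exact tdim_le_iff_dimLT.2 (h n (dimLT_univ_subtype.1 ((indBelow_iff_dimLT n _).1 hn)))

end CoveringByZeroDimensional

section FunctionSpaces

variable {K : Type u} [MetricSpace K] [CompactSpace K]

theorem exists_continuous_pos_on_open {X : Type*} [MetricSpace X] {V : Set X} (hV : IsOpen V) :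
    ∃ v : C(X, ℝ), (∀ x, 0 ≤ v x ∧ v x ≤ 1) ∧ (∀ x ∈ V, 0 < v x) ∧ ∀ x ∉ V, v x = 0 := by
  rcases (Vᶜ).eq_empty_or_nonempty with h | h
  · have : V = univ := compl_empty_iff.1 h
    subst this
    exact ⟨1, by simp, by simp, by simp⟩
  · refine ⟨⟨fun x => min 1 (infDist x Vᶜ), by fun_prop⟩, fun x => ⟨?_, min_le_left _ _⟩, ?_, ?_⟩
    · exact le_min zero_le_one infDist_nonneg
    · intro x hx
      refine lt_min zero_lt_one ?_
      exact (hV.isClosed_compl.notMem_iff_infDist_pos h).1 (by simpa using hx)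
    · intro x hx
      have : infDist x Vᶜ = 0 := infDist_zero_of_mem hx
      simp [this]

theorem IsZeroDim.exists_approx_ne_zero {Z : Set K} (h : IsZeroDim Z) (φ : C(K, ℝ)) {ε : ℝ}
    (hε : 0 < ε) : ∃ ψ : C(K, ℝ), (∀ x, |ψ x - φ x| ≤ ε) ∧ ∀ x ∈ Z, ψ x ≠ 0 := by
  set δ := ε / 2 with hδ
  have hδ0 : 0 < δ := by positivity
  obtain ⟨V, W, hV, hW, hVW, hAV, hBW, hZ⟩ := h.exists_partition
    (A := {x | φ x ≤ -δ}) (B := {x | δ ≤ φ x})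
    (isClosed_le φ.continuous continuous_const) (isClosed_le continuous_const φ.continuous)
    (disjoint_left.2 fun x (h1 : φ x ≤ -δ) (h2 : δ ≤ φ x) => by linarith)
  obtain ⟨v, hv1, hv2, hv3⟩ := exists_continuous_pos_on_open hV
  obtain ⟨w, hw1, hw2, hw3⟩ := exists_continuous_pos_on_open hW
  refine ⟨⟨fun x => max (φ x - δ) 0 - max (-φ x - δ) 0 + δ * (w x - v x), by fun_prop⟩, ?_, ?_⟩
  · intro x
    have h1 := hv1 x
    have h2 := hw1 x
    have h3 : |δ * (w x - v x)| ≤ δ := by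
      rw [abs_mul, abs_of_pos hδ0]
      have : |w x - v x| ≤ 1 := abs_le.2 ⟨by linarith, by linarith⟩
      nlinarith
    have h4 := abs_le.1 h3
    simp only [ContinuousMap.coe_mk]
    rw [abs_le]
    rcases max_cases (φ x - δ) 0 with ⟨e1, e2⟩ | ⟨e1, e2⟩ <;>
      rcases max_cases (-φ x - δ) 0 with ⟨e3, e4⟩ | ⟨e3, e4⟩ <;>
      rw [e1, e3] <;> constructor <;> linarith
  · intro x hx
    simp only [ContinuousMap.coe_mk]
    rcases hZ hx with h | h
    · have h1 : φ x < δ := by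
        by_contra h'
        exact disjoint_left.1 hVW h (hBW (not_lt.1 h'))
      have h2 : w x = 0 := hw3 x fun h' => disjoint_left.1 hVW h h'
      have h3 := mul_pos hδ0 (hv2 x h)
      rw [max_eq_right (by linarith), h2]
      have := le_max_right (-φ x - δ) 0
      exact ne_of_lt (by linarith)
    · have h1 : -δ < φ x := by
        by_contra h'
        exact disjoint_left.1 hVW (hAV (not_lt.1 h')) h
      have h2 : v x = 0 := hv3 x fun h' => disjoint_left.1 hVW h' h
      have h3 := mul_pos hδ0 (hw2 x h)
      rw [max_eq_right (a := -φ x - δ) (by linarith), h2]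
      have := le_max_right (φ x - δ) 0
      exact ne_of_gt (by linarith)

/-- Maps to `ℝˢ` without zeros on a given set of dimension less than `s` are dense. -/
theorem DimLT.exists_approx_ne_zero {s : ℕ} {M : Set K} (h : DimLT s M) (φ : C(K, Fin s → ℝ))
    {ε : ℝ} (hε : 0 < ε) : ∃ ψ : C(K, Fin s → ℝ), dist ψ φ < ε ∧ ∀ x ∈ M, ψ x ≠ 0 := by
  obtain ⟨Z, hZ, hM⟩ := h
  choose ψ hψ1 hψ2 using fun i => (hZ i).exists_approx_ne_zero
    ((⟨fun y => y i, continuous_apply i⟩ : C(Fin s → ℝ, ℝ)).comp φ) (half_pos hε)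
  refine ⟨ContinuousMap.pi ψ, ?_, fun x hx h0 => ?_⟩
  · refine lt_of_le_of_lt ((ContinuousMap.dist_le (half_pos hε).le).2 fun x => ?_) (half_lt_self hε)
    refine (dist_pi_le_iff (half_pos hε).le).2 fun i => ?_
    rw [Real.dist_eq]
    exact hψ1 i x
  · obtain ⟨i, hi⟩ := mem_iUnion.1 (hM hx)
    exact hψ2 i x hi (congrFun h0 i)

/-- The map selecting finitely many terms of a bounded sequence of functions. -/
noncomputable def selectTerms {n : ℕ} (p : Fin n → ℕ) (F : BoundedContinuousFunction ℕ C(K, ℝ)) :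
    C(K, Fin n → ℝ) :=
  ContinuousMap.pi fun i => F (p i)

theorem selectTerms_apply {n : ℕ} (p : Fin n → ℕ) (F : BoundedContinuousFunction ℕ C(K, ℝ))
    (x : K) (i : Fin n) : selectTerms p F x i = F (p i) x := rfl

theorem continuous_selectTerms {n : ℕ} (p : Fin n → ℕ) :
    Continuous (selectTerms p : BoundedContinuousFunction ℕ C(K, ℝ) → C(K, Fin n → ℝ)) := by
  refine (LipschitzWith.of_dist_le_mul (K := 1) fun F G => ?_).continuous
  rw [NNReal.coe_one, one_mul]
  refine (ContinuousMap.dist_le dist_nonneg).2 fun x => (dist_pi_le_iff dist_nonneg).2 fun i => ?_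
  exact (ContinuousMap.dist_apply_le_dist x).trans (BoundedContinuousFunction.dist_coe_le_dist _)

theorem isOpenMap_selectTerms {n : ℕ} {p : Fin n → ℕ} (hp : Function.Injective p) :
    IsOpenMap (selectTerms p : BoundedContinuousFunction ℕ C(K, ℝ) → C(K, Fin n → ℝ)) := by
  classical
  rw [isOpenMap_iff_nhds_le]
  intro F s hs
  obtain ⟨ε, hε, hεs⟩ := Metric.mem_nhds_iff.1 hs
  refine Metric.mem_nhds_iff.2 ⟨ε, hε, fun G hG => ?_⟩
  let comp : Fin n → C(K, ℝ) := fun i =>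
    (⟨fun y => y i, continuous_apply i⟩ : C(Fin n → ℝ, ℝ)).comp G
  have hcomp : ∀ i, ‖comp i - F (p i)‖ ≤ dist G (selectTerms p F) := by
    intro i
    rw [← dist_eq_norm]
    refine (ContinuousMap.dist_le dist_nonneg).2 fun x => ?_
    exact (dist_le_pi_dist (G x) (selectTerms p F x) i).trans
      (ContinuousMap.dist_apply_le_dist x)
  let H : BoundedContinuousFunction ℕ C(K, ℝ) :=
    BoundedContinuousFunction.ofNormedAddCommGroupDiscrete
      (fun j => if h : ∃ i, p i = j then comp h.choose - F j else 0)
      (dist G (selectTerms p F)) (by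
        intro j
        split_ifs with h
        · have := hcomp h.choose
          rwa [h.choose_spec] at this
        · simp)
  have hFH : F + H ∈ ball F ε := by
    refine mem_ball.2 (lt_of_le_of_lt ((BoundedContinuousFunction.dist_le dist_nonneg).2
      fun j => ?_) (mem_ball.1 hG))
    rw [BoundedContinuousFunction.add_apply, dist_eq_norm, add_sub_cancel_left]
    show ‖if h : ∃ i, p i = j then comp h.choose - F j else 0‖ ≤ _
    split_ifs with h
    · have := hcomp h.choose
      rwa [h.choose_spec] at this
    · simp
  have heq : selectTerms p (F + H) = G := by
    ext x i
    rw [selectTerms_apply]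
    have h : ∃ i', p i' = p i := ⟨i, rfl⟩
    have hH : H (p i) = comp i - F (p i) := by
      show (if h : ∃ i', p i' = p i then comp h.choose - F (p i) else 0) = _
      rw [dif_pos h, hp h.choose_spec]
    rw [BoundedContinuousFunction.add_apply, hH, add_sub_cancel]
    rfl
  have := hεs hFH
  rw [mem_preimage, heq] at this
  exact this

/-- Given a sequence of functions which separates points from closed sets infinitely often, the
set of points where fewer than `n` of them vanish has dimension less than `n`. -/
theorem dimLT_of_few_zeros {n : ℕ} (F : ℕ → C(K, ℝ))
    (hF : ∀ (x : K) (U : Set K), IsOpen U → x ∈ U → ∀ P : Finset ℕ, ∃ p ∉ P,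
      F p x < 0 ∧ ∀ y ∉ U, 0 < F p y) :
    DimLT n {x | {p | F p x = 0}.encard < n} := by
  refine ⟨fun j => {x | {p | F p x = 0}.encard = (j : ℕ)}, fun j => ?_, ?_⟩
  · refine IsZeroDim.of_closed_cover' (ι := {P : Finset ℕ // P.card = j})
      (C := fun P => ⋂ p ∈ P.1, {x | F p x = 0})
      (fun P => isClosed_biInter fun p _ => isClosed_eq (F p).continuous continuous_const) ?_ ?_
    · rintro ⟨P, hP⟩
      have key : ∀ x ∈ {x | {p | F p x = 0}.encard = (j : ℕ)} ∩ ⋂ p ∈ P, {x | F p x = 0},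
          ∀ p, p ∉ P → F p x ≠ 0 := by
        rintro x ⟨hx1, hx2⟩ p hp hpx
        have hsub : (P : Set ℕ) ⊆ {p | F p x = 0} := fun q hq => mem_iInter₂.1 hx2 q hq
        have hfin : {p | F p x = 0}.Finite := by
          rw [← Set.encard_lt_top_iff, hx1]; exact ENat.natCast_lt_top _
        have := P.finite_toSet.eq_of_subset_of_encard_le hsub (by
          rw [hx1, Set.encard_coe_eq_coe_finsetCard, hP])
        have h' : p ∈ (P : Set ℕ) := by rw [this]; exact hpx
        exact hp h'
      intro x hx U hU hxU
      obtain ⟨p, hp, h1, h2⟩ := hF x U hU hxU P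
      refine ⟨{y | F p y < 0}, {y | 0 < F p y}, isOpen_lt (F p).continuous continuous_const,
        isOpen_lt continuous_const (F p).continuous, h1, ?_, ?_, ?_⟩
      · intro y hy
        exact lt_or_gt_of_ne (key y hy p hp)
      · refine eq_empty_of_subset_empty ?_
        rintro y ⟨⟨-, hy1⟩, hy2⟩
        exact lt_asymm (show F p y < 0 from hy1) hy2
      · rintro y ⟨-, hy⟩
        by_contra hyU
        exact lt_asymm (show F p y < 0 from hy) (h2 y hyU)
    · intro x hx
      have hfin : {p | F p x = 0}.Finite := by
        rw [← Set.encard_lt_top_iff, show {p | F p x = 0}.encard = _ from hx]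
        exact ENat.natCast_lt_top _
      refine mem_iUnion.2 ⟨⟨hfin.toFinset, ?_⟩, ?_⟩
      · have : {p | F p x = 0}.encard = (j : ℕ) := hx
        rw [hfin.encard_eq_coe_toFinset_card] at this
        exact_mod_cast this
      · refine mem_iInter₂.2 fun p hp => ?_
        exact hfin.mem_toFinset.1 hp
  · intro x hx
    have hx' : {p | F p x = 0}.encard < n := hx
    obtain ⟨m, hm⟩ := ENat.ne_top_iff_exists.1 (hx'.trans (ENat.natCast_lt_top _)).ne
    rw [← hm] at hx'
    exact mem_iUnion.2 ⟨⟨m, by exact_mod_cast hx'⟩, hm.symm⟩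

theorem exists_separating_seq [Nonempty K] :
    ∃ h : ℕ → C(K, ℝ), (∀ p x, |h p x| ≤ 1) ∧
      ∀ (x : K) (U : Set K), IsOpen U → x ∈ U → ∀ P : Finset ℕ, ∃ p ∉ P,
        h p x = -1 ∧ ∀ y ∉ U, h p y = 1 := by
  refine ⟨fun p => ⟨fun x => max (-1) (min 1 (((p.unpair.2 : ℝ) + 1) *
    dist x (denseSeq K p.unpair.1) - 2)), by fun_prop⟩, fun p x => ?_, ?_⟩
  · exact abs_le.2 ⟨le_max_left _ _, max_le (by norm_num) (min_le_left _ _)⟩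
  · intro x U hU hxU P
    obtain ⟨ε, hε, hεU⟩ := Metric.isOpen_iff.1 hU x hxU
    obtain ⟨k₀, hk₀⟩ := exists_nat_gt (4 / ε)
    set k := max k₀ (P.sup (fun p => p.unpair.2) + 1) with hk
    have hk1 : 0 < (k : ℝ) + 1 := by positivity
    obtain ⟨i, hi⟩ := (denseRange_denseSeq K).exists_dist_lt x (one_div_pos.2 hk1)
    refine ⟨Nat.pair i k, fun hP => ?_, ?_, fun y hy => ?_⟩
    · have := Finset.le_sup (f := fun p => (Nat.unpair p).2) hP
      simp only [Nat.unpair_pair] at this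
      have h2 := le_max_right k₀ (P.sup (fun p => p.unpair.2) + 1)
      omega
    · simp only [ContinuousMap.coe_mk, Nat.unpair_pair]
      have : ((k : ℝ) + 1) * dist x (denseSeq K i) < 1 := by
        rw [lt_div_iff₀ hk1] at hi; linarith
      rw [min_eq_right (by linarith), max_eq_left (by linarith)]
    · simp only [ContinuousMap.coe_mk, Nat.unpair_pair]
      have h1 : ε ≤ dist y x := by
        by_contra h'
        exact hy (hεU (mem_ball.2 (not_le.1 h')))
      have h2 : 4 ≤ ((k : ℝ) + 1) * ε := by
        have : (k₀ : ℝ) ≤ k := by exact_mod_cast le_max_left _ _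
        have h3 : 4 / ε < (k : ℝ) + 1 := by linarith
        rw [div_lt_iff₀ hε] at h3
        exact h3.le
      have h3 : ((k : ℝ) + 1) * dist x (denseSeq K i) < 1 := by
        rw [lt_div_iff₀ hk1] at hi; linarith
      have h4 := dist_triangle_right y x (denseSeq K i)
      have h5 : ((k : ℝ) + 1) * ε ≤ ((k : ℝ) + 1) * dist y (denseSeq K i) +
          ((k : ℝ) + 1) * dist x (denseSeq K i) := by
        rw [← mul_add]
        exact mul_le_mul_of_nonneg_left (h1.trans h4) hk1.le
      rw [min_eq_left (by linarith), max_eq_right (by norm_num)]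

/-- Any co-meager set of maps to `ℝⁿ` contains a countable family such that the common complement
of the zero sets has dimension less than `n`. -/
theorem exists_countable_family_of_residual [Nonempty K] {n : ℕ} {G : Set C(K, Fin n → ℝ)}
    (hG : G ∈ residual C(K, Fin n → ℝ)) :
    ∃ g : {p : Fin n → ℕ // Function.Injective p} → C(K, Fin n → ℝ), (∀ p, g p ∈ G) ∧
      DimLT n {x | ∀ p, g p x ≠ 0} := by
  obtain ⟨h, hb, hsep⟩ := exists_separating_seq (K := K)
  let H : BoundedContinuousFunction ℕ C(K, ℝ) :=
    BoundedContinuousFunction.ofNormedAddCommGroupDiscrete h 1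
      fun p => (ContinuousMap.norm_le _ zero_le_one).2 (hb p)
  have hres : (⋂ p : {p : Fin n → ℕ // Function.Injective p}, selectTerms p.1 ⁻¹' G) ∈
      residual (BoundedContinuousFunction ℕ C(K, ℝ)) :=
    countable_iInter_mem.2 fun p => tendsto_residual_of_isOpenMap (continuous_selectTerms p.1)
      (isOpenMap_selectTerms p.2) hG
  obtain ⟨F, hFH, hF⟩ := (dense_of_mem_residual hres).exists_mem_open isOpen_ball
    ⟨H, mem_ball_self zero_lt_one⟩
  have hFh : ∀ p x, |F p x - h p x| < 1 := fun p x => by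
    have h1 : dist (F p x) (H p x) ≤ dist (F p) (H p) := ContinuousMap.dist_apply_le_dist x
    have h2 : dist (F p) (H p) ≤ dist F H := BoundedContinuousFunction.dist_coe_le_dist p
    have h3 : dist F H < 1 := hF
    rw [Real.dist_eq] at h1
    exact (h1.trans h2).trans_lt h3
  refine ⟨fun p => selectTerms p.1 F, fun p => mem_iInter.1 hFH p, ?_⟩
  refine (dimLT_of_few_zeros (fun p => F p) ?_).mono ?_
  · intro x U hU hxU P
    obtain ⟨p, hp, h1, h2⟩ := hsep x U hU hxU P
    refine ⟨p, hp, ?_, fun y hy => ?_⟩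
    · have := (abs_lt.1 (hFh p x)).2
      rw [h1] at this; linarith
    · have := (abs_lt.1 (hFh p y)).1
      rw [h2 y hy] at this; linarith
  · intro x hx
    by_contra hcon
    have hcon' : (n : ℕ∞) ≤ {p | F p x = 0}.encard := not_lt.1 hcon
    obtain ⟨t, hts, htn⟩ := Set.exists_subset_encard_eq hcon'
    have htf : t.Finite := Set.finite_of_encard_eq_coe htn
    have hcard : htf.toFinset.card = n := by
      rw [htf.encard_eq_coe_toFinset_card] at htn; exact_mod_cast htn
    let e := htf.toFinset.orderEmbOfFin hcard
    refine hx ⟨e, e.injective⟩ ?_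
    ext i
    exact hts (htf.mem_toFinset.1 (htf.toFinset.orderEmbOfFin_mem hcard i))

theorem isOpen_setOf_forall_ne {n : ℕ} {C : Set K} (hC : IsClosed C) (y : Fin n → ℝ) :
    IsOpen {f : C(K, Fin n → ℝ) | ∀ x ∈ C, f x ≠ y} :=
  ContinuousMap.isOpen_setOfPred_mapsTo hC.isCompact (isOpen_compl_singleton (x := y))

/-- On a closed set of dimension at least `n` some map to `ℝⁿ` has `0` as a stable value. -/
theorem exists_stable_zero [Nonempty K] {n : ℕ} {C : Set K} (hC : IsClosed C) (h : ¬ DimLT n C) :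
    ∃ f₁ : C(K, Fin n → ℝ), ∃ ε > 0, ∀ f, dist f f₁ < ε → ∃ x ∈ C, f x = 0 := by
  by_contra! hcon
  have hd : Dense {f : C(K, Fin n → ℝ) | ∀ x ∈ C, f x ≠ 0} := by
    rw [Metric.dense_iff]
    intro f r hr
    obtain ⟨g, hg, hgC⟩ := hcon f r hr
    exact ⟨g, hg, hgC⟩
  obtain ⟨g, hg, hgd⟩ := exists_countable_family_of_residual
    (residual_of_dense_open (isOpen_setOf_forall_ne hC 0) hd)
  exact h (hgd.mono fun x hx p => hg p x hx)

end FunctionSpaces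

section LocalModification

variable {K : Type u} [MetricSpace K] [CompactSpace K]

theorem exists_local_modification {n : ℕ} (f₀ : C(K, Fin n → ℝ)) (x₀ : K) (y : Fin n → ℝ)
    {r R : ℝ} (hR : 0 < R) (hr : dist (f₀ x₀) y < r) :
    ∃ η ∈ Ioo 0 R, ∀ f₁ : C(K, Fin n → ℝ), ∃ l > (0 : ℝ), ∃ h : C(K, Fin n → ℝ), dist h f₀ < r ∧
      (∀ x, R ≤ dist x x₀ → h x = f₀ x) ∧ ∀ x ∈ closedBall x₀ η, h x = y + l • f₁ x := by
  obtain ⟨c, hc1, hc2⟩ := exists_between hr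
  have hc0 : 0 ≤ c := dist_nonneg.trans hc1.le
  have hopen : IsOpen {x | dist (f₀ x) y < c} := isOpen_lt (by fun_prop) continuous_const
  obtain ⟨ρ, hρ, hρs⟩ := Metric.isOpen_iff.1 hopen x₀ hc1
  have hm : 0 < min ρ R := lt_min hρ hR
  set η := min ρ R / 2 with hη
  have hη0 : 0 < η := half_pos hm
  have h2η : 2 * η = min ρ R := by rw [hη]; ring
  refine ⟨η, ⟨hη0, (half_lt_self hm).trans_le (min_le_right _ _)⟩, fun f₁ => ?_⟩
  set l := (r - c) / 2 / (‖f₁‖ + 1) with hl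
  have hN : 0 < ‖f₁‖ + 1 := by positivity
  have hl0 : 0 < l := by
    have : 0 < r - c := sub_pos.2 hc2
    positivity
  have hlf : ∀ x, ‖l • f₁ x‖ ≤ (r - c) / 2 := fun x => by
    rw [norm_smul, Real.norm_of_nonneg hl0.le]
    have h1 := f₁.norm_coe_le_norm x
    calc l * ‖f₁ x‖ ≤ l * (‖f₁‖ + 1) := by gcongr; linarith
      _ = (r - c) / 2 := by rw [hl]; field_simp
  let χ : K → ℝ := fun x => max 0 (min 1 (2 - dist x x₀ / η))
  have hχc : Continuous χ := by fun_prop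
  have hχ0 : ∀ x, 0 ≤ χ x := fun x => le_max_left _ _
  have hχ1 : ∀ x, χ x ≤ 1 := fun x => max_le zero_le_one (min_le_left _ _)
  have hχout : ∀ x, 2 * η ≤ dist x x₀ → χ x = 0 := fun x hx => by
    have : 2 ≤ dist x x₀ / η := by rwa [le_div_iff₀ hη0]
    exact max_eq_left ((min_le_right _ _).trans (by linarith))
  have hχin : ∀ x ∈ closedBall x₀ η, χ x = 1 := fun x hx => by
    have : dist x x₀ / η ≤ 1 := by rw [div_le_one hη0]; exact hx
    show max 0 (min 1 (2 - dist x x₀ / η)) = 1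
    rw [min_eq_left (by linarith), max_eq_right zero_le_one]
  refine ⟨l, hl0, ⟨fun x => f₀ x + χ x • (y + l • f₁ x - f₀ x), by fun_prop⟩, ?_, ?_, ?_⟩
  · refine lt_of_le_of_lt ((ContinuousMap.dist_le (C := c + (r - c) / 2) (by linarith)).2
      fun x => ?_) (by linarith)
    rw [ContinuousMap.coe_mk, dist_eq_norm, add_sub_cancel_left]
    rcases le_or_gt (2 * η) (dist x x₀) with hx | hx
    · rw [hχout x hx, zero_smul, norm_zero]; linarith
    · have h1 : dist (f₀ x) y < c := hρs (mem_ball.2 (hx.trans_le (h2η.le.trans (min_le_left _ _))))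
      have h2 : ‖y + l • f₁ x - f₀ x‖ ≤ c + (r - c) / 2 := by
        have : y + l • f₁ x - f₀ x = (y - f₀ x) + l • f₁ x := by abel
        rw [this]
        refine (norm_add_le _ _).trans (add_le_add ?_ (hlf x))
        rw [← dist_eq_norm, dist_comm]; exact h1.le
      rw [norm_smul, Real.norm_of_nonneg (hχ0 x)]
      calc χ x * ‖y + l • f₁ x - f₀ x‖ ≤ 1 * ‖y + l • f₁ x - f₀ x‖ := by gcongr; exact hχ1 x
        _ ≤ _ := by rw [one_mul]; exact h2
  · intro x hx
    rw [ContinuousMap.coe_mk, hχout x ((h2η.le.trans (min_le_right _ _)).trans hx), zero_smul,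
      add_zero]
  · intro x hx
    rw [ContinuousMap.coe_mk, hχin x hx, one_smul, add_sub_cancel]

/-- Local behaviour near the zeros of `f₁`, stable under small perturbations, can be transplanted
into any map, close to any given point. -/
theorem exists_transplant {n : ℕ} (f₀ : C(K, Fin n → ℝ)) (x₀ : K) (y : Fin n → ℝ)
    {r R : ℝ} (hR : 0 < R) (hr : dist (f₀ x₀) y < r) :
    ∃ η ∈ Ioo 0 R, ∀ (f₁ : C(K, Fin n → ℝ)) (ε : ℝ), 0 < ε → ∃ δ > 0, ∃ h : C(K, Fin n → ℝ),
      dist h f₀ < r ∧ (∀ x, R ≤ dist x x₀ → h x = f₀ x) ∧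
      ∀ g, dist g h < δ → ∃ f, dist f f₁ < ε ∧ ∀ x ∈ closedBall x₀ η, g x = y ↔ f x = 0 := by
  obtain ⟨η, hη, H⟩ := exists_local_modification f₀ x₀ y hR hr
  refine ⟨η, hη, fun f₁ ε hε => ?_⟩
  obtain ⟨l, hl, h, h1, h2, h3⟩ := H f₁
  refine ⟨l * ε, mul_pos hl hε, h, h1, h2, fun g hg => ⟨f₁ + l⁻¹ • (g - h), ?_, fun x hx => ?_⟩⟩
  · rw [dist_eq_norm, add_sub_cancel_left, norm_smul, norm_inv, Real.norm_of_nonneg hl.le,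
      ← dist_eq_norm, inv_mul_lt_iff₀ hl]
    exact hg
  · have : (f₁ + l⁻¹ • (g - h)) x = l⁻¹ • (g x - y) := by
      ext i
      simp only [ContinuousMap.add_apply, ContinuousMap.smul_apply, ContinuousMap.sub_apply,
        h3 x hx, Pi.add_apply, Pi.smul_apply, Pi.sub_apply, smul_eq_mul]
      field_simp
      ring
    rw [this, smul_eq_zero_iff_right (inv_ne_zero hl.ne'), sub_eq_zero]

theorem mem_residual_of_forall_open {Y : Type*} [TopologicalSpace Y] {S : Set Y}
    (h : ∀ U : Set Y, IsOpen U → U.Nonempty → ∃ V ⊆ S, IsOpen V ∧ (U ∩ V).Nonempty) :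
    S ∈ residual Y := by
  refine mem_of_superset (residual_of_dense_open isOpen_interior ?_) interior_subset
  rw [dense_iff_inter_open]
  intro U hU hne
  obtain ⟨V, hVS, hV, hUV⟩ := h U hU hne
  exact hUV.mono (inter_subset_inter_right _ (interior_maximal hVS hV))

/-- A property of maps is generic if near every map there is a ball of maps with this property. -/
theorem mem_residual_of_forall_ball {Y : Type*} [PseudoMetricSpace Y] {S : Set Y}
    (h : ∀ f₀ : Y, ∀ r > 0, ∃ g, dist g f₀ < r ∧ ∃ δ > 0, ball g δ ⊆ S) : S ∈ residual Y := by
  refine mem_residual_of_forall_open fun U hU ⟨f₀, hf₀⟩ => ?_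
  obtain ⟨r, hr, hrU⟩ := Metric.isOpen_iff.1 hU f₀ hf₀
  obtain ⟨g, hg, δ, hδ, hgS⟩ := h f₀ r hr
  exact ⟨ball g δ, hgS, isOpen_ball, g, hrU hg, mem_ball_self hδ⟩

end LocalModification

section FiniteFibres

variable {K : Type u} [MetricSpace K] [CompactSpace K]

theorem exists_injective_approx (a : ℕ → ℝ) {δ : ℝ} (hδ : 0 < δ) (N : ℕ) :
    ∃ c : ℕ → ℝ, (∀ i, |c i - a i| < δ) ∧ InjOn c (Iio N) := by
  induction N with
  | zero => exact ⟨a, by simpa using hδ, by simp [InjOn]⟩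
  | succ N ih =>
    obtain ⟨c, hc, hinj⟩ := ih
    have hinf : (ball (a N) δ).Infinite := by
      rw [Real.ball_eq_Ioo]; exact Ioo_infinite (by linarith)
    obtain ⟨t, ht, htn⟩ := hinf.exists_notMem_finite ((finite_Iio N).image c)
    refine ⟨Function.update c N t, fun i => ?_, fun i hi j hj hij => ?_⟩
    · rcases eq_or_ne i N with rfl | h
      · rw [Function.update_self]; exact ht
      · rw [Function.update_of_ne h]; exact hc i
    · have hlt : ∀ {k}, k ∈ Iio (N + 1) → k ≠ N → k ∈ Iio N := fun {k} hk hkN =>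
        lt_of_le_of_ne (Nat.lt_succ_iff.1 hk) hkN
      rcases eq_or_ne i N with rfl | h <;> rcases eq_or_ne j i with rfl | h'
      · rfl
      · rw [Function.update_self, Function.update_of_ne h'] at hij
        exact (htn ⟨j, hlt hj h', hij.symm⟩).elim
      · rfl
      · rcases eq_or_ne j N with rfl | h2
        · rw [Function.update_self, Function.update_of_ne h] at hij
          exact (htn ⟨i, hlt hi h, hij⟩).elim
        · rw [Function.update_of_ne h, Function.update_of_ne h2] at hij
          exact hinj (hlt hi h) (hlt hj h2) hij

/-- The maps which are constant on some `ε`-separated `m`-tuple of points of `M`. -/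
def spreadFibre (n m : ℕ) (M : Set K) (ε : ℝ) : Set C(K, Fin n → ℝ) :=
  {f | ∃ x : Fin m → K, (∀ i, x i ∈ M) ∧ (∀ i j, i ≠ j → ε ≤ dist (x i) (x j)) ∧
    ∀ i j, f (x i) = f (x j)}

theorem isClosed_spreadFibre {n m : ℕ} {M : Set K} (hM : IsClosed M) {ε : ℝ} :
    IsClosed (spreadFibre n m M ε) := by
  have h : IsClosed {p : C(K, Fin n → ℝ) × (Fin m → K) | (∀ i, p.2 i ∈ M) ∧
      (∀ i j, i ≠ j → ε ≤ dist (p.2 i) (p.2 j)) ∧ ∀ i j, p.1 (p.2 i) = p.1 (p.2 j)} := by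
    simp only [ofPred_and, ofPred_forall]
    refine (isClosed_iInter fun i => hM.preimage (by fun_prop)).inter
      ((isClosed_iInter fun i => isClosed_iInter fun j => isClosed_iInter fun _ =>
        isClosed_le continuous_const (by fun_prop)).inter
      (isClosed_iInter fun i => isClosed_iInter fun j => isClosed_eq (by fun_prop) (by fun_prop)))
  convert isClosedMap_fst_of_compactSpace _ h
  ext f
  simp [spreadFibre]

theorem DimLT.exists_approx_notMem_spreadFibre [Nonempty K] {n : ℕ} {M : Set K} (hM : IsClosed M)
    (h : DimLT n M) {ε : ℝ} (hε : 0 < ε) (f : C(K, Fin n → ℝ)) {r : ℝ} (hr : 0 < r) :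
    ∃ g, dist g f < r ∧ g ∉ spreadFibre n (n + 1) M ε := by
  obtain ⟨Z, hZ, hMZ⟩ := h
  obtain ⟨δ, hδ, hδr⟩ : ∃ δ, 0 < δ ∧ 2 * δ < r := ⟨r / 4, by positivity, by linarith⟩
  obtain ⟨ρ, hρ, hρf⟩ := Metric.uniformContinuous_iff.1
    (CompactSpace.uniformContinuous_of_continuous f.continuous) δ hδ
  set σ := min ρ (ε / 2) with hσ
  have hσ0 : 0 < σ := lt_min hρ (half_pos hε)
  choose D hDo hDd hDc hDs using fun k => (hZ k).exists_refinement (range fun x => ball x σ)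
    (by rintro _ ⟨x, rfl⟩; exact isOpen_ball)
    fun x _ => ⟨_, ⟨x, rfl⟩, mem_ball_self hσ0⟩
  have hcen : ∀ k i, ∃ z : K, D k i ⊆ ball z σ ∨ D k i = ∅ := by
    intro k i
    rcases hDs k i with h | ⟨_, ⟨z, rfl⟩, hz⟩
    · exact ⟨Classical.arbitrary K, Or.inr h⟩
    · exact ⟨z, Or.inl hz⟩
  choose z hz using hcen
  have hzD : ∀ k i, ∀ x ∈ D k i, dist x (z k i) < σ := fun k i x hx => by
    rcases hz k i with h | h
    · exact h hx
    · rw [h] at hx; exact hx.elim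
  choose v hv1 hv2 hv3 using fun k i => exists_continuous_pos_on_open (hDo k i)
  obtain ⟨m, hm⟩ := hM.isCompact.elim_directed_cover
    (fun m : ℕ => ⋃ k, ⋃ i ∈ Iio m, {x | 1 / ((m : ℝ) + 1) < v k i x})
    (fun m => isOpen_iUnion fun k => isOpen_biUnion fun i _ =>
      isOpen_lt continuous_const (v k i).continuous)
    (fun x hx => by
      obtain ⟨k, hk⟩ := mem_iUnion.1 (hMZ hx)
      obtain ⟨i, hi⟩ := mem_iUnion.1 (hDc k hk)
      obtain ⟨m, hm⟩ := exists_nat_one_div_lt (hv2 k i x hi)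
      refine mem_iUnion.2 ⟨max m (i + 1), mem_iUnion.2 ⟨k, mem_iUnion₂.2 ⟨i, ?_, ?_⟩⟩⟩
      · exact lt_of_lt_of_le (Nat.lt_succ_self i) (le_max_right _ _)
      · refine lt_of_le_of_lt ?_ hm
        have : (m : ℝ) ≤ (max m (i + 1) : ℕ) := by exact_mod_cast le_max_left _ _
        exact one_div_le_one_div_of_le (by positivity) (by linarith))
    (Monotone.directed_le fun a b hab => by
      refine iUnion_mono fun k => ?_
      refine iUnion₂_subset fun i hi => subset_iUnion₂_of_subset i (lt_of_lt_of_le hi hab) ?_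
      intro x hx
      have : (a : ℝ) + 1 ≤ (b : ℝ) + 1 := by gcongr
      exact lt_of_le_of_lt (one_div_le_one_div_of_le (by positivity) this)
        (show 1 / ((a : ℝ) + 1) < v k i x from hx))
  choose c hc hcinj using fun k => exists_injective_approx (fun i => f (z k i) k) hδ m
  let χ : Fin n → ℕ → K → ℝ := fun k i x => min 1 (((m : ℝ) + 1) * v k i x)
  have hχ1 : ∀ k i x, |χ k i x| ≤ 1 := fun k i x => by
    have h0 : 0 ≤ χ k i x := le_min zero_le_one (mul_nonneg (by positivity) (hv1 k i x).1)
    rw [abs_of_nonneg h0]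
    exact min_le_left _ _
  have hχ0 : ∀ k i, ∀ x ∉ D k i, χ k i x = 0 := fun k i x hx => by
    simp [χ, hv3 k i x hx]
  let g : C(K, Fin n → ℝ) := ⟨fun x k => f x k + ∑ i ∈ Finset.range m, χ k i x * (c k i - f x k),
    by fun_prop⟩
  have hg : ∀ k, ∀ i < m, ∀ x ∈ D k i, g x k = f x k + χ k i x * (c k i - f x k) := by
    intro k i hi x hx
    show f x k + _ = _
    rw [Finset.sum_eq_single_of_mem i (Finset.mem_range.2 hi)]
    intro j _ hj
    rw [hχ0 k j x fun hxj => disjoint_left.1 (hDd k hj) hxj hx, zero_mul]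
  refine ⟨g, lt_of_le_of_lt ((ContinuousMap.dist_le (C := 2 * δ) (by positivity)).2 fun x =>
    (dist_pi_le_iff (by positivity)).2 fun k => ?_) hδr, ?_⟩
  · by_cases hx : ∃ i < m, x ∈ D k i
    · obtain ⟨i, hi, hxi⟩ := hx
      rw [hg k i hi x hxi, Real.dist_eq, add_sub_cancel_left, abs_mul]
      have h1 : |f x k - f (z k i) k| < δ := by
        have := hρf ((hzD k i x hxi).trans_le (min_le_left _ _))
        exact (dist_le_pi_dist (f x) (f (z k i)) k).trans_lt this
      have h2 : |c k i - f x k| ≤ 2 * δ := by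
        rw [abs_sub_comm] at h1
        have := abs_sub_le (c k i) (f (z k i) k) (f x k)
        linarith [hc k i]
      calc |χ k i x| * |c k i - f x k| ≤ 1 * |c k i - f x k| := by gcongr; exact hχ1 k i x
        _ ≤ _ := by rw [one_mul]; exact h2
    · have : g x k = f x k := by
        show f x k + _ = _
        rw [Finset.sum_eq_zero, add_zero]
        intro i hi
        rw [hχ0 k i x fun hxi => hx ⟨i, Finset.mem_range.1 hi, hxi⟩, zero_mul]
      rw [this, dist_self]; positivity
  · rintro ⟨x, hxM, hxd, hxg⟩
    have : ∀ j, ∃ k i, i < m ∧ x j ∈ D k i ∧ g (x j) k = c k i := by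
      intro j
      obtain ⟨k, hk⟩ := mem_iUnion.1 (hm (hxM j))
      obtain ⟨i, hi, hik⟩ := mem_iUnion₂.1 hk
      have hik' : 1 / ((m : ℝ) + 1) < v k i (x j) := hik
      have hD : x j ∈ D k i := by
        by_contra h
        rw [hv3 k i _ h] at hik'
        exact absurd hik' (not_lt.2 (by positivity))
      refine ⟨k, i, hi, hD, ?_⟩
      have hχ : χ k i (x j) = 1 := by
        refine min_eq_left ?_
        rw [div_lt_iff₀ (by positivity)] at hik'
        linarith
      rw [hg k i hi _ hD, hχ]
      ring
    choose k i hi hD hgc using this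
    obtain ⟨a, b, hab, hkab⟩ := Fintype.exists_ne_map_eq_of_card_lt k (by simp)
    have hcab : c (k a) (i a) = c (k a) (i b) := by
      rw [← hgc a, hkab, ← hgc b, hxg a b]
    have hiab := hcinj (k a) (hi a) (hi b) hcab
    have h1 := hzD _ _ _ (hD a)
    have h2 := hzD _ _ _ (hD b)
    rw [← hkab, ← hiab] at h2
    have h3 := dist_triangle_right (x a) (x b) (z (k a) (i a))
    have h4 : σ ≤ ε / 2 := min_le_right _ _
    linarith [hxd a b hab]

/-- Generic maps to `ℝⁿ` have finite fibres on a given `F_σ` set of dimension less than `n`. -/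
theorem DimLT.eventually_finite_fibre [Nonempty K] {n : ℕ} {C : ℕ → Set K} (hC : ∀ i, IsClosed (C i))
    (h : DimLT n (⋃ i, C i)) :
    ∀ᶠ f : C(K, Fin n → ℝ) in residual C(K, Fin n → ℝ), ∀ y, (f ⁻¹' {y} ∩ ⋃ i, C i).Finite := by
  have hM : ∀ j, IsClosed (⋃ i ∈ Iic j, C i) := fun j =>
    (finite_Iic j).isClosed_biUnion fun i _ => hC i
  have key : ∀ p : ℕ × ℕ, ∀ᶠ f in residual C(K, Fin n → ℝ),
      f ∉ spreadFibre n (n + 1) (⋃ i ∈ Iic p.1, C i) (1 / ((p.2 : ℝ) + 1)) := by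
    rintro ⟨j, m⟩
    refine residual_of_dense_open (isClosed_spreadFibre (hM j)).isOpen_compl ?_
    rw [Metric.dense_iff]
    intro f r hr
    obtain ⟨g, hg, hg'⟩ := (h.mono (iUnion₂_subset fun i _ => subset_iUnion C i) :
      DimLT n (⋃ i ∈ Iic j, C i)).exists_approx_notMem_spreadFibre (hM j)
      (one_div_pos.2 (by positivity : (0 : ℝ) < m + 1)) f hr
    exact ⟨g, hg, hg'⟩
  filter_upwards [eventually_countable_forall.2 key] with f hf y
  by_contra hinf
  obtain ⟨t, hts, htc⟩ := Set.Infinite.exists_subset_card_eq hinf (n + 1)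
  let e : Fin (n + 1) ≃ t := (t.equivFinOfCardEq htc).symm
  have he : ∀ a, ∃ i, (e a : K) ∈ C i := fun a => mem_iUnion.1 (hts (e a).2).2
  choose i hi using he
  obtain ⟨m, hm⟩ : ∃ m : ℕ, ∀ a b, a ≠ b → 1 / ((m : ℝ) + 1) ≤ dist (e a : K) (e b) := by
    have : ∀ p : Fin (n + 1) × Fin (n + 1), ∃ m : ℕ, p.1 ≠ p.2 →
        1 / ((m : ℝ) + 1) < dist (e p.1 : K) (e p.2) := by
      intro p
      by_cases hp : p.1 = p.2
      · exact ⟨0, fun h => (h hp).elim⟩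
      · obtain ⟨m, hm⟩ := exists_nat_one_div_lt (dist_pos.2 (show (e p.1 : K) ≠ e p.2 from
          fun h => hp (e.injective (Subtype.ext h))))
        exact ⟨m, fun _ => hm⟩
    choose m hm using this
    refine ⟨Finset.univ.sup m, fun a b hab => le_trans ?_ (hm (a, b) hab).le⟩
    have : (m (a, b) : ℝ) ≤ (Finset.univ.sup m : ℕ) := by
      exact_mod_cast Finset.le_sup (Finset.mem_univ (a, b))
    exact one_div_le_one_div_of_le (by positivity) (by linarith)
  refine hf (Finset.univ.sup i, m) ⟨fun a => e a, fun a => ?_, hm, fun a b => ?_⟩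
  · exact mem_iUnion₂.2 ⟨i a, mem_Iic.2 (Finset.le_sup (f := i) (Finset.mem_univ a)), hi a⟩
  · exact ((hts (e a).2).1 : f (e a) = y).trans ((hts (e b).2).1 : f (e b) = y).symm

end FiniteFibres

section Packing

variable {X : Type u} [MetricSpace X]

theorem IsPacking.mono {A B : Set X} {δ ε : ℝ≥0} {s t : Set (X × ℝ≥0)} (h : IsPacking B ε t)
    (hst : s ⊆ t) (h' : ∀ p ∈ s, p.1 ∈ A ∧ p.2 ≤ δ) : IsPacking A δ s :=
  ⟨h.1.mono hst, h', h.2.2.mono hst⟩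

theorem packPre_mono {h : ℝ≥0 → ℝ≥0} {A B : Set X} (hAB : A ⊆ B) {δ ε : ℝ≥0} (hδ : δ ≤ ε) :
    packPre h A δ ≤ packPre h B ε :=
  iSup₂_le fun s hs => le_iSup₂_of_le s
    (hs.mono subset_rfl fun p hp => ⟨hAB (hs.2.1 p hp).1, (hs.2.1 p hp).2.trans hδ⟩) le_rfl

theorem packPre0_mono {h : ℝ≥0 → ℝ≥0} {A B : Set X} (hAB : A ⊆ B) :
    packPre0 h A ≤ packPre0 h B :=
  iInf₂_mono fun _ _ => packPre_mono hAB le_rfl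

theorem packPre0_lt_top_of_finite (s : ℝ≥0) {S : Set X} (hS : S.Finite) :
    packPre0 (fun r => r ^ (s : ℝ)) S < ∞ := by
  refine lt_of_le_of_lt (iInf₂_le_of_le 1 one_pos (iSup₂_le fun t ht => ?_))
    (ENNReal.coe_lt_top (r := (hS.toFinset.card : ℝ≥0)))
  have hinj : Function.Injective fun p : t => (⟨p.1.1, (ht.2.1 p.1 p.2).1⟩ : S) := by
    intro p q hpq
    by_contra hne
    have hpq' : p.1.1 = q.1.1 := congrArg Subtype.val hpq
    refine disjoint_left.1 (ht.2.2 p.2 q.2 fun h => hne (Subtype.ext h))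
      (mem_closedBall_self p.1.2.coe_nonneg) ?_
    rw [hpq']
    exact mem_closedBall_self q.1.2.coe_nonneg
  have := hS.fintype
  calc ∑' p : t, ((p.1.2 ^ (s : ℝ) : ℝ≥0) : ℝ≥0∞) ≤ ∑' _ : t, (1 : ℝ≥0∞) := by
        refine ENNReal.tsum_le_tsum fun p => ?_
        exact_mod_cast NNReal.rpow_le_one (ht.2.1 p.1 p.2).2 s.coe_nonneg
    _ ≤ ∑' _ : S, (1 : ℝ≥0∞) := ENNReal.tsum_comp_le_tsum_of_injective hinj fun _ => 1
    _ ≤ _ := by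
        rw [tsum_fintype, Finset.sum_const, Finset.card_univ, nsmul_one, hS.card_toFinset]
        simp

theorem packPre_rpow_le {s s' : ℝ≥0} (hs : s ≤ s') (A : Set X) (δ : ℝ≥0) :
    packPre (fun r => r ^ (s' : ℝ)) A δ ≤
      ((δ ^ ((s' : ℝ) - s) : ℝ≥0) : ℝ≥0∞) * packPre (fun r => r ^ (s : ℝ)) A δ := by
  refine iSup₂_le fun t ht => ?_
  have hs' : 0 ≤ (s' : ℝ) - s := sub_nonneg.2 hs
  calc ∑' p : t, ((p.1.2 ^ (s' : ℝ) : ℝ≥0) : ℝ≥0∞)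
      ≤ ∑' p : t, ((δ ^ ((s' : ℝ) - s) : ℝ≥0) : ℝ≥0∞) * ((p.1.2 ^ (s : ℝ) : ℝ≥0) : ℝ≥0∞) := by
        refine ENNReal.tsum_le_tsum fun p => ?_
        rw [← ENNReal.coe_mul, ENNReal.coe_le_coe]
        calc p.1.2 ^ (s' : ℝ) = p.1.2 ^ ((s' : ℝ) - s + s) := by rw [sub_add_cancel]
          _ = p.1.2 ^ ((s' : ℝ) - s) * p.1.2 ^ (s : ℝ) :=
              NNReal.rpow_add_of_nonneg _ hs' s.coe_nonneg
          _ ≤ _ := by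
              gcongr
              exact (ht.2.1 p.1 p.2).2
    _ = _ := ENNReal.tsum_mul_left
    _ ≤ _ := by
        gcongr
        exact le_iSup₂ (f := fun (t : Set (X × ℝ≥0)) (_ : IsPacking A δ t) =>
          ∑' p : t, ((p.1.2 ^ (s : ℝ) : ℝ≥0) : ℝ≥0∞)) t ht

theorem packPre0_eq_zero_of_lt {s s' : ℝ≥0} (hs : s < s') {A : Set X}
    (h : packPre0 (fun r => r ^ (s : ℝ)) A < ∞) : packPre0 (fun r => r ^ (s' : ℝ)) A = 0 := by
  obtain ⟨δ₀, hδ₀⟩ := iInf_lt_iff.1 h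
  obtain ⟨hδ₀', hC⟩ := iInf_lt_iff.1 hδ₀
  set C := packPre (fun r => r ^ (s : ℝ)) A δ₀ with hCdef
  have hpos : 0 < (s' : ℝ) - s := sub_pos.2 hs
  have hlim : Tendsto (fun δ : ℝ≥0 => ((δ ^ ((s' : ℝ) - s) : ℝ≥0) : ℝ≥0∞) * C) (𝓝[>] 0)
      (𝓝 (0 * C)) := by
    refine ENNReal.Tendsto.mul_const ?_ (Or.inr hC.ne)
    rw [← ENNReal.coe_zero, ENNReal.tendsto_coe]
    have : Tendsto (fun δ : ℝ≥0 => δ ^ ((s' : ℝ) - s)) (𝓝 0) (𝓝 (0 ^ ((s' : ℝ) - s))) :=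
      (NNReal.continuous_rpow_const hpos.le).tendsto 0
    rw [NNReal.zero_rpow hpos.ne'] at this
    exact this.mono_left nhdsWithin_le_nhds
  rw [zero_mul] at hlim
  refine le_antisymm (ge_of_tendsto hlim ?_) zero_le
  filter_upwards [Ioo_mem_nhdsGT hδ₀'] with δ hδ
  calc packPre0 (fun r => r ^ (s' : ℝ)) A ≤ packPre (fun r => r ^ (s' : ℝ)) A δ :=
        iInf₂_le δ hδ.1
    _ ≤ _ := packPre_rpow_le hs.le A δ
    _ ≤ _ := by
        gcongr
        exact packPre_mono subset_rfl hδ.2.le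

/-- Countable unions of sets of finite `s`-dimensional packing premeasure, and their subsets. -/
def PackSmall (s : ℝ≥0) (A : Set X) : Prop :=
  ∃ c : ℕ → Set X, A ⊆ ⋃ i, c i ∧ ∀ i, packPre0 (fun r => r ^ (s : ℝ)) (c i) < ∞

theorem PackSmall.mono {s : ℝ≥0} {A B : Set X} (h : PackSmall s B) (hAB : A ⊆ B) :
    PackSmall s A := by
  obtain ⟨c, hc, h⟩ := h
  exact ⟨c, hAB.trans hc, h⟩

theorem PackSmall.iUnion {ι : Type*} [Countable ι] {s : ℝ≥0} {A : ι → Set X}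
    (h : ∀ i, PackSmall s (A i)) : PackSmall s (⋃ i, A i) := by
  rcases isEmpty_or_nonempty ι with hι | hι
  · exact ⟨fun _ => ∅, by simp, fun _ => packPre0_lt_top_of_finite s finite_empty⟩
  · choose c hc hfin using h
    obtain ⟨e, he⟩ := exists_surjective_nat ι
    refine ⟨fun j => c (e j.unpair.1) j.unpair.2, fun x hx => ?_, fun j => hfin _ _⟩
    obtain ⟨i, hi⟩ := mem_iUnion.1 hx
    obtain ⟨k, hk⟩ := mem_iUnion.1 (hc i hi)
    obtain ⟨a, rfl⟩ := he i
    exact mem_iUnion.2 ⟨Nat.pair a k, by simpa using hk⟩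

theorem PackSmall.union {s : ℝ≥0} {A B : Set X} (hA : PackSmall s A) (hB : PackSmall s B) :
    PackSmall s (A ∪ B) := by
  rw [union_eq_iUnion]
  exact PackSmall.iUnion (by rintro (_ | _); exacts [hB, hA])

theorem PackSmall.of_finite {s : ℝ≥0} {A : Set X} (hA : A.Finite) : PackSmall s A :=
  ⟨fun _ => A, subset_iUnion (fun _ : ℕ => A) 0, fun _ => packPre0_lt_top_of_finite s hA⟩

theorem PackSmall.of_packMeasure_lt_top {s : ℝ≥0} {A : Set X}
    (h : packMeasure (fun r => r ^ (s : ℝ)) A < ∞) : PackSmall s A := by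
  obtain ⟨c, hc⟩ := iInf_lt_iff.1 h
  obtain ⟨hA, hc⟩ := iInf_lt_iff.1 hc
  exact ⟨c, hA.le, fun i => lt_of_le_of_lt (ENNReal.le_tsum i) hc⟩

theorem PackSmall.packMeasure_eq_zero {s s' : ℝ≥0} (hs : s < s') {A : Set X} (h : PackSmall s A) :
    packMeasure (fun r => r ^ (s' : ℝ)) A = 0 := by
  obtain ⟨c, hc, h⟩ := h
  refine le_antisymm (iInf₂_le_of_le (fun i => c i ∩ A) ?_ ?_) zero_le
  · rw [← iUnion_inter]
    exact (inter_eq_right.2 hc).symm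
  · rw [ENNReal.tsum_eq_zero.2]
    intro i
    exact packPre0_eq_zero_of_lt hs ((packPre0_mono inter_subset_left).trans_lt (h i))

theorem pdim_nonneg {A : Set X} (hA : A.Nonempty) : 0 ≤ pdim A := by
  rw [pdim, if_neg hA.ne_empty]
  exact le_max_left _ _

theorem PackSmall.pdim_le {s : ℝ≥0} {A : Set X} (h : PackSmall s A) :
    pdim A ≤ ((s : ℝ) : EReal) := by
  have hs : (0 : EReal) ≤ ((s : ℝ) : EReal) := by exact_mod_cast s.coe_nonneg
  unfold pdim
  split_ifs
  · exact le_trans (by norm_num) hs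
  · refine max_le hs (iSup₂_le fun t ht => ?_)
    by_contra hlt
    have hlt' : s < t := by exact_mod_cast not_le.1 hlt
    rw [h.packMeasure_eq_zero hlt'] at ht
    exact ENNReal.zero_ne_top ht

theorem le_pdim_of_not_packSmall {s : ℝ≥0} {A : Set X} (h : ¬ PackSmall s A) :
    ((s : ℝ) : EReal) ≤ pdim A := by
  unfold pdim
  split_ifs with hA
  · exact (h (hA ▸ .of_finite finite_empty)).elim
  · refine le_max_of_le_right (le_iSup₂_of_le s ?_ le_rfl)
    by_contra hlt
    exact h (.of_packMeasure_lt_top (lt_top_iff_ne_top.2 hlt))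

theorem pdim_le_pdim_of_subset_union_finite {A S T : Set X} (hA : A.Nonempty) (hS : S.Finite)
    (hT : T ⊆ A ∪ S) : pdim T ≤ pdim A := by
  refine le_of_forall_gt_imp_ge_of_dense fun q hq => ?_
  obtain ⟨t, htA, htq⟩ := EReal.lt_iff_exists_real_btwn.1 hq
  have ht0 : 0 ≤ t := by exact_mod_cast (pdim_nonneg hA).trans htA.le
  lift t to ℝ≥0 using ht0
  have : PackSmall t A := by
    by_contra h
    exact absurd (le_pdim_of_not_packSmall h) (not_le.2 htA)
  exact ((this.union (.of_finite hS)).mono hT).pdim_le.trans htq.le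

theorem hdim_nonneg {A : Set X} (hA : A.Nonempty) : 0 ≤ hdim A := by
  rw [hdim, if_neg hA.ne_empty]
  exact_mod_cast zero_le

theorem hdim_le_hdim_of_subset_union_finite {A S T : Set X} (hA : A.Nonempty) (hS : S.Finite)
    (hT : T ⊆ A ∪ S) : hdim T ≤ hdim A := by
  rcases T.eq_empty_or_nonempty with rfl | hTne
  · rw [hdim, if_pos rfl]
    exact le_trans (by norm_num) (hdim_nonneg hA)
  · rw [hdim, hdim, if_neg hTne.ne_empty, if_neg hA.ne_empty, EReal.coe_ennreal_le_coe_ennreal_iff]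
    refine (dimH_mono hT).trans ?_
    rw [dimH_union, dimH_finite hS, max_eq_left zero_le]

theorem tdim_le_tdim_of_subset_union_finite [SecondCountableTopology X] {A S T : Set X}
    (hA : A.Nonempty) (hS : S.Finite) (hT : T ⊆ A ∪ S) : tdim T ≤ tdim A := by
  refine tdim_le_tdim fun m hm => ?_
  rcases m.eq_zero_or_pos with rfl | h
  · obtain ⟨Z, -, hZ⟩ := hm
    obtain ⟨x, hx⟩ := hA
    obtain ⟨i, -⟩ := mem_iUnion.1 (hZ hx)
    exact i.elim0
  · exact (hm.union_finite h hS).mono hT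

/-- Upper bound for the dimension of the fibres of generic maps. -/
theorem eventually_iSup_le_dStar [CompactSpace X] [Nonempty X] {n : ℕ}
    (hX : ¬ DimLT n (univ : Set X)) {dim : Set X → EReal}
    (hdim : ∀ {A S T : Set X}, A.Nonempty → S.Finite → T ⊆ A ∪ S → dim T ≤ dim A) :
    ∀ᶠ f : C(X, Fin n → ℝ) in residual C(X, Fin n → ℝ),
      ⨆ y, dim (f ⁻¹' {y}) ≤ dStar dim n univ := by
  set D : Set EReal := {d : EReal |
    ∃ F : Set X, IsFSigmaIn F univ ∧ tdim F ≤ (n : EReal) - 1 ∧ d = dim (univ \ F)} with hD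
  have hne : D.Nonempty := by
    refine ⟨_, ∅, ⟨fun _ => ∅, fun _ => isClosed_empty, by simp⟩, tdim_le_iff_dimLT.2 ?_, rfl⟩
    exact ⟨fun _ => ∅, fun _ => .empty, empty_subset _⟩
  obtain ⟨u, -, hu, huD⟩ := exists_seq_tendsto_sInf hne (OrderBot.bddBelow D)
  choose F hF hFn hFd using huD
  have key : ∀ k, ∀ᶠ f : C(X, Fin n → ℝ) in residual C(X, Fin n → ℝ),
      ∀ y, dim (f ⁻¹' {y}) ≤ u k := by
    intro k
    obtain ⟨C, hC, hCF⟩ := hF k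
    simp only [inter_univ] at hCF
    have hFk : DimLT n (F k) := tdim_le_iff_dimLT.1 (hFn k)
    have hdl : (univ \ F k).Nonempty := by
      rw [nonempty_iff_ne_empty, Ne, sdiff_eq_empty]
      exact fun h => hX (hFk.mono h)
    rw [hCF] at hFk
    filter_upwards [hFk.eventually_finite_fibre hC] with f hf y
    rw [hFd k]
    refine hdim hdl (hf y) fun x hx => ?_
    by_cases h : x ∈ F k
    · exact Or.inr ⟨hx, hCF ▸ h⟩
    · exact Or.inl ⟨mem_univ x, h⟩
  filter_upwards [eventually_countable_forall.2 key] with f hf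
  exact ge_of_tendsto' hu fun k => iSup_le fun y => hf k y

end Packing

section TopologicalLowerBound

variable {K : Type u} [MetricSpace K] [CompactSpace K]

theorem natCast_succ_sub_one (m : ℕ) : ((m + 1 : ℕ) : EReal) - 1 = (m : EReal) := by
  have h : ((m + 1 : ℕ) : EReal) - 1 = (((m + 1 : ℕ) : ℝ) - 1 : ℝ) := by
    push_cast; rfl
  rw [h, Nat.cast_succ, add_sub_cancel_right]
  rfl

theorem le_tdim_of_not_dimLT {X : Type u} [MetricSpace X] [SecondCountableTopology X] {s : ℕ}
    {A : Set X} (h : ¬ DimLT s A) : (s : EReal) ≤ tdim A := by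
  refine le_sInf ?_
  rintro _ ⟨m, hm, rfl⟩
  have hm' : DimLT m A := dimLT_univ_subtype.1 ((indBelow_iff_dimLT m _).1 hm)
  have hlt : s < m := by
    by_contra hle
    exact h (hm'.mono_nat (not_lt.1 hle))
  obtain ⟨k, rfl⟩ := Nat.exists_eq_add_of_lt hlt
  rw [natCast_succ_sub_one]
  exact_mod_cast Nat.le_add_right s k

theorem dStar_univ_le {X : Type u} [MetricSpace X] [SecondCountableTopology X] {n : ℕ}
    {dim : Set X → EReal} {G : Set X} (hG : IsGδ G) (h : DimLT n Gᶜ) :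
    dStar dim n univ ≤ dim G := by
  obtain ⟨U, hU, rfl⟩ := isGδ_iff_eq_iInter_nat.1 hG
  refine sInf_le ⟨(⋂ i, U i)ᶜ, ⟨fun i => (U i)ᶜ, fun i => (hU i).isClosed_compl, ?_⟩,
    tdim_le_iff_dimLT.2 h, ?_⟩
  · simp only [inter_univ, compl_iInter]
  · rw [← compl_eq_univ_sdiff, compl_compl]

theorem DimLT.exists_isGδ_compl {X : Type u} [MetricSpace X] [SecondCountableTopology X]
    {n s : ℕ} (h : DimLT (n + s) (univ : Set X)) :
    ∃ G : Set X, IsGδ G ∧ DimLT n Gᶜ ∧ DimLT s G := by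
  obtain ⟨Z, hZ, hu⟩ := h
  have hs : DimLT s (⋃ i, Z (Fin.natAdd n i)) :=
    ⟨fun i => Z (Fin.natAdd n i), fun i => hZ _, subset_rfl⟩
  obtain ⟨G, hG, hsub, hGs⟩ := hs.exists_isGδ
  refine ⟨G, hG, ⟨fun i => Z (Fin.castAdd s i), fun i => hZ _, fun x hx => ?_⟩, hGs⟩
  obtain ⟨i, hi⟩ := mem_iUnion.1 (hu (mem_univ x))
  induction i using Fin.addCases with
  | left i => exact mem_iUnion.2 ⟨i, hi⟩
  | right i => exact (hx (hsub (mem_iUnion.2 ⟨i, hi⟩))).elim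

/-- The pairing of two maps to Euclidean spaces. -/
def appendMap {n s : ℕ} (f : C(K, Fin n → ℝ)) (g : C(K, Fin s → ℝ)) : C(K, Fin (n + s) → ℝ) where
  toFun x := Fin.append (f x) (g x)
  continuous_toFun := continuous_pi fun i => by
    induction i using Fin.addCases with
    | left i => simp only [Fin.append_left]; fun_prop
    | right i => simp only [Fin.append_right]; fun_prop

theorem eventually_exists_not_dimLT_fibre {n s : ℕ} (h : ¬ DimLT (n + s) (univ : Set K)) :
    ∀ᶠ f : C(K, Fin n → ℝ) in residual C(K, Fin n → ℝ), ∃ y, ¬ DimLT s (f ⁻¹' {y}) := by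
  have hne : Nonempty K := by
    by_contra hK
    rw [not_nonempty_iff] at hK
    exact h ⟨fun _ => ∅, fun _ => .empty, fun x => hK.elim x⟩
  refine mem_residual_of_forall_ball fun f₀ r hr => ?_
  choose η hη H using fun x => exists_transplant f₀ x (f₀ x) one_pos (by rwa [dist_self])
  obtain ⟨x₀, hx₀⟩ : ∃ x, ¬ DimLT (n + s) (closedBall x (η x)) := by
    by_contra! hcon
    obtain ⟨t, -, ht⟩ := (isCompact_univ (X := K)).elim_nhds_subcover
      (fun x => closedBall x (η x)) fun x _ => closedBall_mem_nhds x (hη x).1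
    refine h (DimLT.of_closed_cover (ι := t) (C := fun x => closedBall x.1 (η x.1))
      (fun x => isClosed_closedBall) (fun x => (hcon x).mono inter_subset_right) ?_)
    rwa [iUnion_subtype]
  obtain ⟨F, ε, hε, hF⟩ := exists_stable_zero isClosed_closedBall hx₀
  let f₁ : C(K, Fin n → ℝ) := ⟨fun x i => F x (Fin.castAdd s i), by fun_prop⟩
  let ψ₁ : C(K, Fin s → ℝ) := ⟨fun x i => F x (Fin.natAdd n i), by fun_prop⟩
  have hB : ∀ f, dist f f₁ < ε / 2 → ¬ DimLT s ({x | f x = 0} ∩ closedBall x₀ (η x₀)) := by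
    intro f hf hd
    obtain ⟨ψ, hψ, hψ0⟩ := hd.exists_approx_ne_zero ψ₁ (half_pos hε)
    obtain ⟨x, hx, hx0⟩ := hF (appendMap f ψ) (by
      refine lt_of_le_of_lt ((ContinuousMap.dist_le (half_pos hε).le).2 fun x =>
        (dist_pi_le_iff (half_pos hε).le).2 fun i => ?_) (half_lt_self hε)
      show dist (Fin.append (f x) (ψ x) i) (F x i) ≤ _
      induction i using Fin.addCases with
      | left i =>
        rw [Fin.append_left]
        exact (dist_le_pi_dist (f x) (f₁ x) i).trans
          ((ContinuousMap.dist_apply_le_dist x).trans hf.le)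
      | right i =>
        rw [Fin.append_right]
        exact (dist_le_pi_dist (ψ x) (ψ₁ x) i).trans
          ((ContinuousMap.dist_apply_le_dist x).trans hψ.le))
    refine hψ0 x ⟨?_, hx⟩ ?_
    · ext i
      have := congrFun hx0 (Fin.castAdd s i)
      rwa [show appendMap f ψ x (Fin.castAdd s i) = f x i from Fin.append_left ..] at this
    · ext i
      have := congrFun hx0 (Fin.natAdd n i)
      rwa [show appendMap f ψ x (Fin.natAdd n i) = ψ x i from Fin.append_right ..] at this
  obtain ⟨δ, hδ, g, hg, -, hgδ⟩ := H x₀ f₁ (ε / 2) (half_pos hε)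
  refine ⟨g, hg, δ, hδ, fun g' hg' => ⟨f₀ x₀, fun hd => ?_⟩⟩
  obtain ⟨f, hf, hfg⟩ := hgδ g' hg'
  exact hB f hf (hd.mono fun x hx => (hfg x hx.2).2 hx.1)

theorem eventually_exists_le_tdim_fibre {n : ℕ} (hK : ¬ DimLT n (univ : Set K)) {q : ℝ}
    (hq : (q : EReal) < dStar tdim n (univ : Set K)) :
    ∀ᶠ f : C(K, Fin n → ℝ) in residual C(K, Fin n → ℝ), ∃ y, (q : EReal) ≤ tdim (f ⁻¹' {y}) := by
  have h : ¬ DimLT (n + ⌈q⌉₊) (univ : Set K) := by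
    intro h
    rcases hs : ⌈q⌉₊ with _ | k
    · rw [hs] at h
      exact hK h
    · rw [hs] at h
      obtain ⟨G, hG, hGn, hGs⟩ := h.exists_isGδ_compl
      have h1 := hq.trans_le ((dStar_univ_le hG hGn).trans (tdim_le_iff_dimLT.2 hGs))
      have h2 : (k : ℝ) < q := Nat.lt_ceil.1 (by omega)
      rw [natCast_succ_sub_one] at h1
      have h3 : q < (k : ℝ) := by exact_mod_cast h1
      exact lt_asymm h2 h3
  filter_upwards [eventually_exists_not_dimLT_fibre h] with f ⟨y, hy⟩
  refine ⟨y, le_trans ?_ (le_tdim_of_not_dimLT hy)⟩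
  exact_mod_cast Nat.le_ceil q

end TopologicalLowerBound

section HausdorffLowerBound

variable {K : Type u} [MetricSpace K]

/-- `M` has an open cover with `∑ (diam cᵢ) ^ s < δ`. -/
def HausdorffSmall (s : ℝ≥0) (δ : ℝ≥0∞) (M : Set K) : Prop :=
  ∃ c : ℕ → Set K, (∀ i, IsOpen (c i)) ∧ M ⊆ ⋃ i, c i ∧ ∑' i, ediam (c i) ^ (s : ℝ) < δ

theorem HausdorffSmall.mono {s : ℝ≥0} {δ : ℝ≥0∞} {M N : Set K} (h : HausdorffSmall s δ N)
    (hMN : M ⊆ N) : HausdorffSmall s δ M := by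
  obtain ⟨c, hc, hN, hs⟩ := h
  exact ⟨c, hc, hMN.trans hN, hs⟩

theorem exists_open_superset_ediam_rpow_lt {s : ℝ≥0} (t : Set K) (ht : ediam t ≠ ∞)
    {ε : ℝ≥0∞} (hε : 0 < ε) (hs : 0 < s) :
    ∃ U, IsOpen U ∧ t ⊆ U ∧ ediam U ^ (s : ℝ) ≤ (⨆ _ : t.Nonempty, ediam t ^ (s : ℝ)) + ε := by
  have hs' : (0 : ℝ) < s := hs
  rcases t.eq_empty_or_nonempty with rfl | hne
  · exact ⟨∅, isOpen_empty, subset_rfl, by simp [hs']⟩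
  · have hfin : ediam t ^ (s : ℝ) ≠ ∞ := ENNReal.rpow_ne_top_of_nonneg hs'.le ht
    have hc : Tendsto (fun η : ℝ≥0 => (ediam t + 2 * (η : ℝ≥0∞)) ^ (s : ℝ)) (𝓝[>] 0)
        (𝓝 (ediam t ^ (s : ℝ))) := by
      have h1 : Continuous fun η : ℝ≥0 => (ediam t + 2 * (η : ℝ≥0∞)) ^ (s : ℝ) :=
        ENNReal.continuous_rpow_const.comp (continuous_const.add
          ((ENNReal.continuous_const_mul (by simp)).comp ENNReal.continuous_coe))
      have h2 := h1.tendsto 0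
      simp only [ENNReal.coe_zero, mul_zero, add_zero] at h2
      exact h2.mono_left nhdsWithin_le_nhds
    have hlt : ediam t ^ (s : ℝ) < ediam t ^ (s : ℝ) + ε := ENNReal.lt_add_right hfin hε.ne'
    obtain ⟨η, hη, hη0⟩ := ((hc.eventually (gt_mem_nhds hlt)).and self_mem_nhdsWithin).exists
    refine ⟨thickening η t, isOpen_thickening, self_subset_thickening (by exact_mod_cast hη0) t, ?_⟩
    rw [ciSup_pos hne]
    refine le_trans ?_ hη.le
    gcongr
    exact ediam_thickening_le η

section Measure

variable [MeasurableSpace K] [BorelSpace K]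

theorem hausdorffMeasure_eq_zero_of_hausdorffSmall {s : ℝ≥0} (hs : 0 < s) {M : Set K}
    (h : ∀ n : ℕ, HausdorffSmall s (n : ℝ≥0∞)⁻¹ M) :
    MeasureTheory.Measure.hausdorffMeasure s M = 0 := by
  choose c _ hM hsum using h
  have hs' : (0 : ℝ) < s := hs
  have hlim : Tendsto (fun n : ℕ => (n : ℝ≥0∞)⁻¹) atTop (𝓝 0) := ENNReal.tendsto_inv_nat_nhds_zero
  have hr : Tendsto (fun n : ℕ => ((n : ℝ≥0∞)⁻¹) ^ ((s : ℝ)⁻¹)) atTop (𝓝 0) := by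
    have := (ENNReal.continuous_rpow_const (y := (s : ℝ)⁻¹)).tendsto 0
    rw [ENNReal.zero_rpow_of_pos (inv_pos.2 hs')] at this
    exact this.comp hlim
  have := MeasureTheory.Measure.hausdorffMeasure_le_liminf_tsum (s : ℝ) M _ hr (fun n i => c n i)
    (Eventually.of_forall fun n i => ?_) (Eventually.of_forall hM)
  · refine le_antisymm (this.trans ?_) zero_le
    rw [← hlim.liminf_eq]
    exact liminf_le_liminf (Eventually.of_forall fun n => (hsum n).le)
  · rw [ENNReal.le_rpow_inv_iff hs']
    exact (ENNReal.le_tsum i).trans (hsum n).le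

theorem HausdorffSmall.of_hausdorffMeasure_eq_zero {s : ℝ≥0} (hs : 0 < s) {M : Set K}
    (h : MeasureTheory.Measure.hausdorffMeasure s M = 0) {δ : ℝ≥0∞} (hδ : 0 < δ) :
    HausdorffSmall s δ M := by
  rw [MeasureTheory.Measure.hausdorffMeasure_apply] at h
  have h1 := ENNReal.iSup_eq_zero.1 (ENNReal.iSup_eq_zero.1 h 1) one_pos
  obtain ⟨δ', hδ', hδ'δ⟩ := exists_between hδ
  obtain ⟨ε, hε, hε'⟩ := ENNReal.exists_pos_sum_of_countable' (tsub_pos_of_lt hδ'δ).ne' ℕ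
  obtain ⟨t, ht⟩ := iInf_lt_iff.1 (h1.trans_lt hδ')
  obtain ⟨hMt, ht⟩ := iInf_lt_iff.1 ht
  obtain ⟨htd, ht⟩ := iInf_lt_iff.1 ht
  choose U hU htU hUd using fun i => exists_open_superset_ediam_rpow_lt (t i)
    (ne_top_of_le_ne_top ENNReal.one_ne_top (htd i)) (hε i) hs
  refine ⟨U, hU, hMt.trans (iUnion_mono htU), ?_⟩
  refine lt_of_le_of_lt (ENNReal.tsum_le_tsum hUd) ?_
  rw [ENNReal.tsum_add]
  calc _ < δ' + (δ - δ') := ENNReal.add_lt_add ht hε'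
    _ = δ := add_tsub_cancel_of_le hδ'δ.le

theorem exists_isGδ_hausdorffMeasure_eq_zero {s : ℝ≥0} (hs : 0 < s) {M : Set K}
    (h : MeasureTheory.Measure.hausdorffMeasure s M = 0) :
    ∃ G : Set K, IsGδ G ∧ M ⊆ G ∧ MeasureTheory.Measure.hausdorffMeasure s G = 0 := by
  choose c hc hM hsum using fun n : ℕ => HausdorffSmall.of_hausdorffMeasure_eq_zero hs h
    (ENNReal.inv_pos.2 (ENNReal.natCast_ne_top n))
  refine ⟨⋂ n, ⋃ i, c n i, .iInter_of_isOpen fun n => isOpen_iUnion (hc n), subset_iInter hM, ?_⟩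
  exact hausdorffMeasure_eq_zero_of_hausdorffSmall hs fun n => ⟨c n, hc n, iInter_subset _ n, hsum n⟩

end Measure

variable [CompactSpace K]

theorem isOpen_setOf_hausdorffSmall {n : ℕ} (s : ℝ≥0) (δ : ℝ≥0∞) {B : Set K} (hB : IsClosed B) :
    IsOpen {f : C(K, Fin n → ℝ) | HausdorffSmall s δ ({x | f x = 0} ∩ B)} := by
  rw [isOpen_iff_mem_nhds]
  rintro f ⟨c, hc, hM, hs⟩
  have hcl : IsClosed (B \ ⋃ i, c i) := hB.sdiff (isOpen_iUnion hc)
  refine mem_of_superset ((isOpen_setOf_forall_ne hcl 0).mem_nhds fun x hx h0 =>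
    hx.2 (hM ⟨h0, hx.1⟩)) fun g hg => ⟨c, hc, fun x hx => ?_, hs⟩
  by_contra hxc
  exact hg x ⟨hx.2, hxc⟩ hx.1

theorem eventually_exists_le_hdim_fibre [Nonempty K] {n : ℕ} {s : ℝ≥0} (hs : 0 < s)
    (hd : ((s : ℝ) : EReal) < dStar hdim n (univ : Set K)) :
    ∀ᶠ f : C(K, Fin n → ℝ) in residual C(K, Fin n → ℝ),
      ∃ y, ((s : ℝ) : EReal) ≤ hdim (f ⁻¹' {y}) := by
  borelize K
  refine mem_residual_of_forall_ball fun f₀ r hr => ?_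
  choose η hη H using fun x => exists_transplant f₀ x (f₀ x) one_pos (by rwa [dist_self])
  obtain ⟨x₀, k, hx₀⟩ : ∃ x, ∃ k : ℕ, ¬ Dense {f : C(K, Fin n → ℝ) |
      HausdorffSmall s (k : ℝ≥0∞)⁻¹ ({x | f x = 0} ∩ closedBall x (η x))} := by
    by_contra! hcon
    obtain ⟨t, -, ht⟩ := (isCompact_univ (X := K)).elim_nhds_subcover
      (fun x => closedBall x (η x)) fun x _ => closedBall_mem_nhds x (hη x).1
    have hres : ∀ p : t × ℕ, {f : C(K, Fin n → ℝ) | HausdorffSmall s (p.2 : ℝ≥0∞)⁻¹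
        ({x | f x = 0} ∩ closedBall p.1.1 (η p.1.1))} ∈ residual C(K, Fin n → ℝ) := fun p =>
      residual_of_dense_open (isOpen_setOf_hausdorffSmall s _ isClosed_closedBall) (hcon p.1 p.2)
    obtain ⟨g, hg, hgd⟩ := exists_countable_family_of_residual (countable_iInter_mem.2 hres)
    have hz : MeasureTheory.Measure.hausdorffMeasure (s : ℝ) (⋃ p, ⋃ x : t,
        {z | g p z = 0} ∩ closedBall x.1 (η x.1)) = 0 :=
      MeasureTheory.measure_iUnion_null fun p => MeasureTheory.measure_iUnion_null fun x =>
        hausdorffMeasure_eq_zero_of_hausdorffSmall hs fun k => mem_iInter.1 (hg p) (x, k)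
    obtain ⟨G, hG, hsub, hG0⟩ := exists_isGδ_hausdorffMeasure_eq_zero hs hz
    have hle : hdim G ≤ ((s : ℝ) : EReal) := by
      unfold hdim
      split_ifs
      · refine le_trans ?_ (EReal.coe_le_coe_iff.2 s.coe_nonneg)
        norm_num
      · have : dimH G ≤ s := dimH_le_of_hausdorffMeasure_ne_top (by rw [hG0]; simp)
        exact EReal.coe_ennreal_le_coe_ennreal_iff.2 this
    refine absurd ((dStar_univ_le hG (hgd.mono fun x hx p h0 => hx (hsub ?_))).trans hle)
      (not_le.2 hd)
    obtain ⟨i, hi, hxi⟩ := mem_iUnion₂.1 (ht (mem_univ x))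
    exact mem_iUnion.2 ⟨p, mem_iUnion.2 ⟨⟨i, hi⟩, h0, hxi⟩⟩
  rw [Metric.dense_iff] at hx₀
  push Not at hx₀
  obtain ⟨f₁, ε, hε, hf₁⟩ := hx₀
  obtain ⟨δ, hδ, g, hg, -, hgδ⟩ := H x₀ f₁ ε hε
  refine ⟨g, hg, δ, hδ, fun g' hg' => ⟨f₀ x₀, ?_⟩⟩
  obtain ⟨f, hf, hfg⟩ := hgδ g' hg'
  have hns : ¬ HausdorffSmall s (k : ℝ≥0∞)⁻¹ (g' ⁻¹' {f₀ x₀}) := fun hsm =>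
    notMem_empty f (hf₁ ▸ ⟨hf, hsm.mono fun x hx => (hfg x hx.2).2 hx.1⟩)
  have h1 : (s : ℝ≥0∞) ≤ dimH (g' ⁻¹' {f₀ x₀}) := le_dimH_of_hausdorffMeasure_ne_zero fun h0 =>
    hns (.of_hausdorffMeasure_eq_zero hs h0 (ENNReal.inv_pos.2 (ENNReal.natCast_ne_top k)))
  have hne : g' ⁻¹' {f₀ x₀} ≠ ∅ := fun h0 => by
    rw [h0, dimH_empty] at h1
    exact hs.ne' (by simpa using h1)
  rw [hdim, if_neg hne]
  exact EReal.coe_ennreal_le_coe_ennreal_iff.2 h1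

end HausdorffLowerBound

section PackingLowerBound

variable {K : Type u} [MetricSpace K]

theorem sum_le_packPre {ι : Type*} {h : ℝ≥0 → ℝ≥0} {A : Set K} {δ : ℝ≥0} (S : Finset ι)
    {x : ι → K} {r : ι → ℝ≥0} (hx : ∀ i ∈ S, x i ∈ A) (hr : ∀ i ∈ S, r i ≤ δ)
    (hd : ∀ i ∈ S, ∀ j ∈ S, i ≠ j →
      Disjoint (closedBall (x i) (r i : ℝ)) (closedBall (x j) (r j : ℝ))) :
    ((∑ i ∈ S, h (r i) : ℝ≥0) : ℝ≥0∞) ≤ packPre h A δ := by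
  classical
  have hinj : Set.InjOn (fun i => (x i, r i)) S := by
    intro i hi j hj hij
    by_contra hne
    refine disjoint_left.1 (hd i hi j hj hne) (mem_closedBall_self (r i).coe_nonneg) ?_
    have : x i = x j := congrArg Prod.fst hij
    rw [this]
    exact mem_closedBall_self (r j).coe_nonneg
  have hp : IsPacking A δ (S.image fun i => (x i, r i) : Finset (K × ℝ≥0)) := by
    refine ⟨Finset.countable_toSet _, fun p hp => ?_, fun p hp q hq hpq => ?_⟩
    · obtain ⟨i, hi, rfl⟩ := Finset.mem_image.1 hp
      exact ⟨hx i hi, hr i hi⟩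
    · obtain ⟨i, hi, rfl⟩ := Finset.mem_image.1 hp
      obtain ⟨j, hj, rfl⟩ := Finset.mem_image.1 hq
      exact hd i hi j hj fun h => hpq (h ▸ rfl)
  refine le_iSup₂_of_le _ hp ?_
  rw [Finset.tsum_subtype' (S.image fun i => (x i, r i)) fun p : K × ℝ≥0 => ((h p.2 : ℝ≥0) : ℝ≥0∞),
    Finset.sum_image hinj, ENNReal.ofNNReal_finsetSum]

theorem exists_finset_of_packPre0_eq_top {s : ℝ≥0} (hs : 0 < s) {A : Set K}
    (h : packPre0 (fun r => r ^ (s : ℝ)) A = ∞) {δ : ℝ≥0} (hδ : 0 < δ) (m : ℝ≥0) :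
    ∃ S : Finset (K × ℝ≥0), (∀ p ∈ S, p.1 ∈ A ∧ 0 < p.2 ∧ p.2 ≤ δ) ∧
      (∀ p ∈ S, ∀ q ∈ S, p ≠ q → Disjoint (closedBall p.1 (p.2 : ℝ)) (closedBall q.1 (q.2 : ℝ))) ∧
      m ≤ ∑ p ∈ S, p.2 ^ (s : ℝ) := by
  classical
  have h1 : packPre (fun r => r ^ (s : ℝ)) A δ = ∞ := by
    refine top_unique (h ▸ ?_)
    exact iInf₂_le δ hδ
  have h2 : (m : ℝ≥0∞) < packPre (fun r => r ^ (s : ℝ)) A δ := h1 ▸ ENNReal.coe_lt_top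
  obtain ⟨t, ht⟩ := lt_iSup_iff.1 h2
  obtain ⟨htp, ht⟩ := lt_iSup_iff.1 ht
  rw [ENNReal.tsum_eq_iSup_sum] at ht
  obtain ⟨S, hS⟩ := lt_iSup_iff.1 ht
  refine ⟨(S.map (Function.Embedding.subtype _)).filter fun p => 0 < p.2, ?_, ?_, ?_⟩
  · intro p hp
    rw [Finset.mem_filter, Finset.mem_map] at hp
    obtain ⟨⟨q, hq, rfl⟩, hp0⟩ := hp
    exact ⟨(htp.2.1 q q.2).1, hp0, (htp.2.1 q q.2).2⟩
  · intro p hp q hq hpq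
    rw [Finset.mem_filter, Finset.mem_map] at hp hq
    obtain ⟨⟨p, -, rfl⟩, -⟩ := hp
    obtain ⟨⟨q, -, rfl⟩, -⟩ := hq
    exact htp.2.2 p.2 q.2 hpq
  · rw [Finset.sum_filter_of_ne fun p _ hp => ?_, Finset.sum_map]
    · rw [← ENNReal.coe_le_coe, ENNReal.ofNNReal_finsetSum]
      exact hS.le
    · rw [pos_iff_ne_zero]
      rintro h0
      exact hp (by rw [h0, NNReal.zero_rpow (by exact_mod_cast hs.ne')])

theorem dimLT_iUnion_of_isGδ_compl [SecondCountableTopology K] {ι : Type*} [Countable ι] {n : ℕ}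
    {G : ι → Set K} (hG : ∀ i, IsGδ (G i)) (h : ∀ i, DimLT n (G i)ᶜ) :
    DimLT n (⋂ i, G i)ᶜ := by
  choose V hV hGV using fun i => isGδ_iff_eq_iInter_nat.1 (hG i)
  refine (DimLT.iUnion_closed (ι := ι × ℕ) (C := fun p => (V p.1 p.2)ᶜ)
    (fun p => (hV _ _).isClosed_compl) fun p => (h p.1).mono ?_).mono ?_
  · rw [hGV p.1]
    exact compl_subset_compl.2 (iInter_subset _ _)
  · intro x hx
    rw [compl_iInter] at hx
    obtain ⟨i, hi⟩ := mem_iUnion.1 hx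
    rw [hGV i, compl_iInter] at hi
    obtain ⟨j, hj⟩ := mem_iUnion.1 hi
    exact mem_iUnion.2 ⟨(i, j), hj⟩

/-- Sets which are small in the sense of packing measures up to an `F_σ` set of dimension less
than `n`. -/
def PackNegligible (n : ℕ) (s : ℝ≥0) (A : Set K) : Prop :=
  ∃ G : Set K, IsGδ G ∧ DimLT n Gᶜ ∧ PackSmall s (A ∩ G)

theorem PackNegligible.mono {n : ℕ} {s : ℝ≥0} {A B : Set K} (h : PackNegligible n s B)
    (hAB : A ⊆ B) : PackNegligible n s A := by
  obtain ⟨G, hG, hGn, hs⟩ := h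
  exact ⟨G, hG, hGn, hs.mono (inter_subset_inter_left _ hAB)⟩

theorem PackNegligible.iUnion [SecondCountableTopology K] {ι : Type*} [Countable ι] {n : ℕ}
    {s : ℝ≥0} {A : ι → Set K} (h : ∀ i, PackNegligible n s (A i)) :
    PackNegligible n s (⋃ i, A i) := by
  choose G hG hGn hs using h
  refine ⟨⋂ i, G i, .iInter hG, dimLT_iUnion_of_isGδ_compl hG hGn, ?_⟩
  rw [iUnion_inter]
  exact .iUnion fun i => (hs i).mono (inter_subset_inter_right _ (iInter_subset _ i))

theorem PackNegligible.union [SecondCountableTopology K] {n : ℕ} {s : ℝ≥0} {A B : Set K}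
    (hA : PackNegligible n s A) (hB : PackNegligible n s B) : PackNegligible n s (A ∪ B) := by
  rw [union_eq_iUnion]
  exact .iUnion (by rintro (_ | _); exacts [hB, hA])

theorem PackNegligible.of_packSmall {n : ℕ} {s : ℝ≥0} {A : Set K} (h : PackSmall s A) :
    PackNegligible n s A :=
  ⟨univ, .univ, ⟨fun _ => ∅, fun _ => .empty, by simp⟩, h.mono inter_subset_left⟩

theorem PackNegligible.of_dimLT {n : ℕ} {s : ℝ≥0} {A : Set K} (hA : IsClosed A) (h : DimLT n A) :
    PackNegligible n s A :=
  ⟨Aᶜ, hA.isOpen_compl.isGδ, by rwa [compl_compl], by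
    rw [inter_compl_self]; exact .of_finite finite_empty⟩

theorem exists_packing_kernel [SecondCountableTopology K] {n : ℕ} {s : ℝ≥0}
    (h : ¬ PackNegligible n s (univ : Set K)) :
    ∃ P : Set K, IsClosed P ∧ P.Nonempty ∧ ∀ x ∈ P, ∀ η > 0, ¬ DimLT n (P ∩ closedBall x η) ∧
      packPre0 (fun r => r ^ (s : ℝ)) (P ∩ ball x η) = ∞ := by
  set B : Set (Set K) := {b ∈ countableBasis K | PackNegligible n s b} with hB
  have hBc : B.Countable := (countable_countableBasis K).mono fun b hb => hb.1
  have : Countable B := hBc.to_subtype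
  have hneg : PackNegligible n s (⋃ b : B, b.1) := .iUnion fun b => b.2.2
  have hopen : IsOpen (⋃ b : B, b.1) := isOpen_iUnion fun b => isOpen_of_mem_countableBasis b.2.1
  have key : ∀ x ∈ (⋃ b : B, b.1)ᶜ, ∀ η > 0,
      ¬ PackNegligible n s ((⋃ b : B, b.1)ᶜ ∩ ball x η) := by
    intro x hx η hη hcon
    obtain ⟨b, hb, hxb, hbs⟩ := (isBasis_countableBasis K).exists_subset_of_mem_open
      (mem_ball_self hη) (isOpen_ball (x := x))
    refine hx (mem_iUnion.2 ⟨⟨b, hb, (hneg.union hcon).mono fun z hz => ?_⟩, hxb⟩)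
    by_cases hzu : z ∈ ⋃ b : B, b.1
    · exact Or.inl hzu
    · exact Or.inr ⟨hzu, hbs hz⟩
  refine ⟨(⋃ b : B, b.1)ᶜ, hopen.isClosed_compl, ?_, fun x hx η hη => ⟨fun hd => ?_, ?_⟩⟩
  · rw [nonempty_compl]
    exact fun hu => h (hu ▸ hneg)
  · exact key x hx η hη ((PackNegligible.of_dimLT
      (hopen.isClosed_compl.inter isClosed_closedBall) hd).mono
      (inter_subset_inter_right _ ball_subset_closedBall))
  · by_contra hlt
    exact key x hx η hη (.of_packSmall
      ⟨fun _ => _, subset_iUnion (fun _ : ℕ => (⋃ b : B, b.1)ᶜ ∩ ball x η) 0,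
        fun _ => lt_top_iff_ne_top.2 hlt⟩)

theorem not_packNegligible_univ [SecondCountableTopology K] {n : ℕ} {s : ℝ≥0}
    (hd : ((s : ℝ) : EReal) < dStar pdim n (univ : Set K)) :
    ¬ PackNegligible n s (univ : Set K) := by
  rintro ⟨G, hG, hGn, hs⟩
  rw [univ_inter] at hs
  exact not_le.2 hd ((dStar_univ_le hG hGn).trans hs.pdim_le)

/-- The level set of `f` over `y` meets `P ∩ closedBall q (2 * ρ)` near the centres of the balls of
a packing with radii at most `δ` and large `s`-dimensional sum. -/
def HasSpots {n : ℕ} (P : Set K) (s : ℝ≥0) (y : Fin n → ℝ) (q : K) (ρ : ℝ) (δ m : ℝ≥0)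
    (f : C(K, Fin n → ℝ)) : Prop :=
  ∃ S : Finset (K × ℝ≥0), (∀ p ∈ S, 0 < p.2 ∧ p.2 ≤ δ) ∧
    (∀ p ∈ S, ∀ p' ∈ S, p ≠ p' →
      Disjoint (closedBall p.1 (p.2 : ℝ)) (closedBall p'.1 (p'.2 : ℝ))) ∧
    m ≤ ∑ p ∈ S, p.2 ^ (s : ℝ) ∧
    ∀ p ∈ S, ∃ x ∈ P, dist x p.1 ≤ p.2 / 4 ∧ x ∈ closedBall q (2 * ρ) ∧ f x = y

theorem le_packPre_of_hasSpots {n : ℕ} {P c : Set K} {s : ℝ≥0} {y : Fin n → ℝ} {q : K} {ρ : ℝ}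
    {δ m : ℝ≥0} {f : C(K, Fin n → ℝ)} (h : HasSpots P s y q ρ δ m f)
    (hc : ∀ x ∈ P, x ∈ closedBall q (2 * ρ) → f x = y → x ∈ closure c) :
    (((1 / 2) ^ (s : ℝ) * m : ℝ≥0) : ℝ≥0∞) ≤ packPre (fun r => r ^ (s : ℝ)) c δ := by
  obtain ⟨S, hS, hSd, hSm, hSx⟩ := h
  have hex : ∀ p : K × ℝ≥0, ∃ x, p ∈ S → x ∈ c ∧ dist x p.1 ≤ p.2 / 2 := by
    intro p
    by_cases hp : p ∈ S
    · obtain ⟨x, hxP, hxp, hxq, hxy⟩ := hSx p hp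
      have hp4 : 0 < (p.2 : ℝ) / 4 := div_pos (NNReal.coe_pos.2 (hS p hp).1) four_pos
      obtain ⟨z, hzc, hz⟩ := Metric.mem_closure_iff.1 (hc x hxP hxq hxy) _ hp4
      refine ⟨z, fun _ => ⟨hzc, ?_⟩⟩
      have := dist_triangle_left z p.1 x
      linarith
    · exact ⟨p.1, fun h => (hp h).elim⟩
  choose x hx using hex
  have hsub : ∀ p ∈ S, closedBall (x p) ((p.2 / 2 : ℝ≥0) : ℝ) ⊆ closedBall p.1 (p.2 : ℝ) := by
    intro p hp
    refine closedBall_subset_closedBall' ?_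
    have := (hx p hp).2
    push_cast
    linarith
  refine le_trans ?_ (sum_le_packPre S (x := x) (r := fun p => p.2 / 2) (fun p hp => (hx p hp).1)
    (fun p hp => (half_le_self zero_le).trans (hS p hp).2) fun p hp p' hp' hne =>
      (hSd p hp p' hp' hne).mono (hsub p hp) (hsub p' hp'))
  rw [ENNReal.coe_le_coe]
  calc (1 / 2 : ℝ≥0) ^ (s : ℝ) * m ≤ (1 / 2 : ℝ≥0) ^ (s : ℝ) * ∑ p ∈ S, p.2 ^ (s : ℝ) := by gcongr
    _ = ∑ p ∈ S, (p.2 / 2) ^ (s : ℝ) := by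
        rw [Finset.mul_sum]
        refine Finset.sum_congr rfl fun p _ => ?_
        rw [← NNReal.mul_rpow, one_div, inv_mul_eq_div]

variable [CompactSpace K]

/-- Finitely many stable solutions of `f x = y` can be created near the centres of disjoint balls
where `f = y`. -/
theorem exists_approx_stable_spots [Nonempty K] {n : ℕ} {P : Set K} (hP : IsClosed P)
    (hPn : ∀ x ∈ P, ∀ η > 0, ¬ DimLT n (P ∩ closedBall x η)) (f : C(K, Fin n → ℝ)) (y : Fin n → ℝ)
    {r : ℝ} (hr : 0 < r) (S : Finset (K × ℝ≥0))
    (hS : ∀ p ∈ S, p.1 ∈ P ∧ 0 < p.2 ∧ f p.1 = y)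
    (hd : ∀ p ∈ S, ∀ q ∈ S, p ≠ q →
      Disjoint (closedBall p.1 (p.2 : ℝ)) (closedBall q.1 (q.2 : ℝ))) :
    ∃ h : C(K, Fin n → ℝ), dist h f < r ∧
      (∀ x, (∀ p ∈ S, (p.2 : ℝ) / 4 ≤ dist x p.1) → h x = f x) ∧
      ∃ δ > 0, ∀ g, dist g h < δ → ∀ p ∈ S, ∃ x ∈ P, dist x p.1 ≤ p.2 / 4 ∧ g x = y := by
  classical
  induction S using Finset.induction_on with
  | empty => exact ⟨f, by rwa [dist_self], fun _ _ => rfl, 1, one_pos, by simp⟩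
  | insert p S hpS ih =>
    obtain ⟨h, hh, hout, δ, hδ, hstab⟩ := ih (fun q hq => hS q (Finset.mem_insert_of_mem hq))
      fun q hq q' hq' => hd q (Finset.mem_insert_of_mem hq) q' (Finset.mem_insert_of_mem hq')
    obtain ⟨hpP, hp0, hpy⟩ := hS p (Finset.mem_insert_self _ _)
    have hp4 : 0 < (p.2 : ℝ) / 4 := div_pos (NNReal.coe_pos.2 hp0) four_pos
    have hhp : h p.1 = y := by
      rw [hout p.1 fun q hq => ?_, hpy]
      by_contra hlt
      refine disjoint_left.1 (hd p (Finset.mem_insert_self _ _) q (Finset.mem_insert_of_mem hq)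
        (fun hpq => hpS (hpq ▸ hq))) (mem_closedBall_self p.2.coe_nonneg) ?_
      have := q.2.coe_nonneg
      rw [mem_closedBall]
      linarith [not_le.1 hlt]
    have hr' : 0 < min (δ / 2) (r - dist h f) := lt_min (half_pos hδ) (sub_pos.2 hh)
    obtain ⟨η, hη, H⟩ := exists_transplant h p.1 y hp4 (r := min (δ / 2) (r - dist h f))
      (by rwa [hhp, dist_self])
    obtain ⟨f₁, ε, hε, hf₁⟩ := exists_stable_zero (hP.inter isClosed_closedBall)
      (hPn p.1 hpP η hη.1)
    obtain ⟨δ', hδ', h', hh', hout', hstab'⟩ := H f₁ ε hε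
    refine ⟨h', ?_, fun x hx => ?_, min δ' (δ / 2), lt_min hδ' (half_pos hδ), fun g hg => ?_⟩
    · have := dist_triangle h' h f
      have := hh'.trans_le (min_le_right _ _)
      linarith
    · rw [hout' x (hx p (Finset.mem_insert_self _ _)),
        hout x fun q hq => hx q (Finset.mem_insert_of_mem hq)]
    · refine Finset.forall_mem_insert _ _ _ |>.2 ⟨?_, hstab g ?_⟩
      · obtain ⟨f₂, hf₂, hfg⟩ := hstab' g (hg.trans_le (min_le_left _ _))
        obtain ⟨x, ⟨hxP, hxη⟩, hx0⟩ := hf₁ f₂ hf₂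
        exact ⟨x, hxP, (mem_closedBall.1 hxη).trans hη.2.le, (hfg x hxη).2 hx0⟩
      · have h1 := dist_triangle g h' h
        have h2 := hg.trans_le (min_le_right _ _)
        have h3 := hh'.trans_le (min_le_left _ _)
        linarith

theorem eventually_hasSpots [Nonempty K] {n : ℕ} {s : ℝ≥0} (hs : 0 < s) {P : Set K}
    (hP : IsClosed P) (hPn : ∀ x ∈ P, ∀ η > 0, ¬ DimLT n (P ∩ closedBall x η))
    (hPs : ∀ x ∈ P, ∀ η > 0, packPre0 (fun r => r ^ (s : ℝ)) (P ∩ ball x η) = ∞)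
    (y : Fin n → ℝ) (q : K) {ρ : ℝ} (hρ : 0 < ρ) {δ : ℝ≥0} (hδ : 0 < δ) (m : ℝ≥0) :
    ∀ᶠ f : C(K, Fin n → ℝ) in residual C(K, Fin n → ℝ),
      (∃ x ∈ P ∩ closedBall q ρ, f x = y) → HasSpots P s y q ρ δ m f := by
  refine mem_residual_of_forall_ball fun f₀ r hr => ?_
  by_cases hx : ∃ x ∈ P ∩ closedBall q ρ, f₀ x = y
  · obtain ⟨x₀, ⟨hx₀P, hx₀q⟩, hx₀y⟩ := hx
    obtain ⟨η, hη, H⟩ := exists_local_modification f₀ x₀ y (r := r) hρ (by rwa [hx₀y, dist_self])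
    obtain ⟨l, -, h₁, hh₁, -, hy⟩ := H 0
    simp only [ContinuousMap.zero_apply, smul_zero, add_zero] at hy
    have hη2 : 0 < η / 2 := half_pos hη.1
    obtain ⟨S, hS, hSd, hSm⟩ := exists_finset_of_packPre0_eq_top hs (hPs x₀ hx₀P (η / 2) hη2)
      (δ := min δ (Real.toNNReal (η / 2))) (lt_min hδ (Real.toNNReal_pos.2 hη2)) m
    have hSη : ∀ p ∈ S, (p.2 : ℝ) ≤ η / 2 := fun p hp => by
      have := (hS p hp).2.2.trans (min_le_right _ _)
      rwa [← NNReal.coe_le_coe, Real.coe_toNNReal _ hη2.le] at this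
    have hball : ∀ p ∈ S, p.1 ∈ closedBall x₀ η := fun p hp => by
      have h1 : dist p.1 x₀ < η / 2 := (hS p hp).1.2
      have h6 := hη.1
      rw [mem_closedBall]
      linarith
    obtain ⟨h, hh, -, δ', hδ', hstab⟩ := exists_approx_stable_spots hP hPn h₁ y
      (sub_pos.2 hh₁) S (fun p hp => ⟨(hS p hp).1.1, (hS p hp).2.1,
        hy p.1 (hball p hp)⟩) hSd
    refine ⟨h, ?_, δ', hδ', fun g hg _ => ⟨S, fun p hp => ⟨(hS p hp).2.1,
      (hS p hp).2.2.trans (min_le_left _ _)⟩, hSd, hSm, fun p hp => ?_⟩⟩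
    · have := dist_triangle h h₁ f₀
      linarith
    · obtain ⟨x, hxP, hxp, hgx⟩ := hstab g hg p hp
      refine ⟨x, hxP, hxp, ?_, hgx⟩
      have h1 : dist p.1 x₀ < η / 2 := (hS p hp).1.2
      have h2 := mem_closedBall.1 hx₀q
      have h3 := dist_triangle4 x p.1 x₀ q
      have h4 := hSη p hp
      have h5 := hη.2
      have h6 := hη.1
      rw [mem_closedBall]
      linarith
  · push Not at hx
    obtain ⟨δ', hδ', hsub⟩ := Metric.isOpen_iff.1
      (isOpen_setOf_forall_ne (hP.inter isClosed_closedBall) y) f₀ hx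
    refine ⟨f₀, by rwa [dist_self], δ', hδ', fun g hg hex => ?_⟩
    obtain ⟨x, hx, hgx⟩ := hex
    exact (hsub hg x hx hgx).elim

theorem eventually_exists_mem_fibre [Nonempty K] {n : ℕ} {P : Set K} (hP : IsClosed P)
    (hne : P.Nonempty) (hPn : ∀ x ∈ P, ∀ η > 0, ¬ DimLT n (P ∩ closedBall x η)) :
    ∀ᶠ f : C(K, Fin n → ℝ) in residual C(K, Fin n → ℝ),
      ∃ j, ∃ x ∈ P, f x = denseSeq (Fin n → ℝ) j := by
  refine mem_residual_of_forall_ball fun f₀ r hr => ?_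
  obtain ⟨x₀, hx₀⟩ := hne
  obtain ⟨j, hj⟩ := (denseRange_denseSeq (Fin n → ℝ)).exists_dist_lt (f₀ x₀) hr
  obtain ⟨η, hη, H⟩ := exists_transplant f₀ x₀ _ one_pos hj
  obtain ⟨f₁, ε, hε, hf₁⟩ := exists_stable_zero (hP.inter isClosed_closedBall) (hPn x₀ hx₀ η hη.1)
  obtain ⟨δ, hδ, h, hh, -, hstab⟩ := H f₁ ε hε
  refine ⟨h, hh, δ, hδ, fun g hg => ?_⟩
  obtain ⟨f, hf, hfg⟩ := hstab g hg
  obtain ⟨x, hx, hx0⟩ := hf₁ f hf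
  exact ⟨j, x, hx.1, (hfg x hx.2).2 hx0⟩

theorem eventually_exists_le_pdim_fibre [Nonempty K] {n : ℕ} {s : ℝ≥0} (hs : 0 < s)
    (hd : ((s : ℝ) : EReal) < dStar pdim n (univ : Set K)) :
    ∀ᶠ f : C(K, Fin n → ℝ) in residual C(K, Fin n → ℝ),
      ∃ y, ((s : ℝ) : EReal) ≤ pdim (f ⁻¹' {y}) := by
  obtain ⟨P, hP, hPne, hPk⟩ := exists_packing_kernel (not_packNegligible_univ hd)
  have hspots : ∀ t : ℕ × ℕ × ℕ × ℕ, ∀ᶠ f : C(K, Fin n → ℝ) in residual C(K, Fin n → ℝ),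
      (∃ x ∈ P ∩ closedBall (denseSeq K t.2.1) (1 / ((t.2.2.1 : ℝ) + 1)),
        f x = denseSeq (Fin n → ℝ) t.1) →
      HasSpots P s (denseSeq (Fin n → ℝ) t.1) (denseSeq K t.2.1) (1 / ((t.2.2.1 : ℝ) + 1))
        (1 / ((t.2.2.2 : ℝ≥0) + 1)) t.2.2.2 f := fun t =>
    eventually_hasSpots hs hP (fun x hx η hη => (hPk x hx η hη).1)
      (fun x hx η hη => (hPk x hx η hη).2) _ _ (by positivity) (by positivity) _
  filter_upwards [eventually_exists_mem_fibre hP hPne fun x hx η hη => (hPk x hx η hη).1,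
    eventually_countable_forall.2 hspots] with f ⟨j, x₁, hx₁P, hx₁⟩ hf
  refine ⟨denseSeq (Fin n → ℝ) j, le_pdim_of_not_packSmall ?_⟩
  rintro ⟨c, hc, hcfin⟩
  set T : Set K := P ∩ f ⁻¹' {denseSeq (Fin n → ℝ) j} with hT
  have hTcl : IsClosed T := hP.inter (isClosed_singleton.preimage f.continuous)
  have : CompactSpace T := isCompact_iff_compactSpace.1 hTcl.isCompact
  have : Nonempty T := ⟨⟨x₁, hx₁P, hx₁⟩⟩
  obtain ⟨i, x, hx⟩ := nonempty_interior_of_iUnion_of_closed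
    (f := fun i => (Subtype.val ⁻¹' closure (c i) : Set T))
    (fun i => isClosed_closure.preimage continuous_subtype_val) (by
      refine eq_univ_of_forall fun x => ?_
      obtain ⟨i, hi⟩ := mem_iUnion.1 (hc x.2.2)
      exact mem_iUnion.2 ⟨i, subset_closure hi⟩)
  obtain ⟨τ, hτ, hτs⟩ := Metric.isOpen_iff.1 isOpen_interior x hx
  have hτs' : ∀ z ∈ T, dist z x < τ → z ∈ closure (c i) := fun z hz hzx =>
    interior_subset (s := (Subtype.val ⁻¹' closure (c i) : Set T))
      (hτs (show (⟨z, hz⟩ : T) ∈ ball x τ from hzx))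
  obtain ⟨k, hk⟩ := exists_nat_one_div_lt (div_pos hτ four_pos)
  have hk0 : 0 < 1 / ((k : ℝ) + 1) := by positivity
  obtain ⟨b, hb⟩ := (denseRange_denseSeq K).exists_dist_lt (x : K) hk0
  obtain ⟨δ₀, hδ₀⟩ := iInf_lt_iff.1 (hcfin i)
  obtain ⟨hδ₀', hfin⟩ := iInf_lt_iff.1 hδ₀
  have hlow : ∀ m : ℕ, 1 / ((m : ℝ≥0) + 1) ≤ δ₀ → (((1 / 2) ^ (s : ℝ) * m : ℝ≥0) : ℝ≥0∞) ≤
      packPre (fun r => r ^ (s : ℝ)) (c i) δ₀ := by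
    intro m hm
    refine (le_packPre_of_hasSpots (hf (j, b, k, m) ⟨x, ⟨x.2.1, hb.le⟩, x.2.2⟩)
      fun z hzP hzb hzy => hτs' z ⟨hzP, hzy⟩ ?_).trans (packPre_mono subset_rfl hm)
    have h1 := mem_closedBall.1 hzb
    have h2 := dist_triangle_right z (x : K) (denseSeq K b)
    dsimp only at h1
    linarith
  lift packPre (fun r => r ^ (s : ℝ)) (c i) δ₀ to ℝ≥0 using hfin.ne with C
  obtain ⟨m₁, hm₁⟩ := exists_nat_gt (C / (1 / 2) ^ (s : ℝ))
  obtain ⟨m₂, hm₂⟩ := exists_nat_one_div_lt hδ₀'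
  have hpos : (0 : ℝ≥0) < (1 / 2) ^ (s : ℝ) := NNReal.rpow_pos (by positivity)
  have hm := hlow (max m₁ m₂) (le_trans (one_div_le_one_div_of_le (by positivity) (by
    gcongr; exact le_max_right _ _)) hm₂.le)
  rw [ENNReal.coe_le_coe] at hm
  rw [div_lt_iff₀ hpos] at hm₁
  refine absurd hm (not_le.2 (hm₁.trans_le ?_))
  rw [mul_comm]
  gcongr
  exact le_max_left _ _

end PackingLowerBound

section GenericEquality

variable {K : Type u} [MetricSpace K]

theorem eventually_dStar_le_iSup {dim : Set K → EReal} {n : ℕ}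
    (h : ∀ q : ℝ, (q : EReal) < dStar dim n (univ : Set K) →
      ∀ᶠ f : C(K, Fin n → ℝ) in residual C(K, Fin n → ℝ), ∃ y, (q : EReal) ≤ dim (f ⁻¹' {y})) :
    ∀ᶠ f : C(K, Fin n → ℝ) in residual C(K, Fin n → ℝ),
      dStar dim n (univ : Set K) ≤ ⨆ y, dim (f ⁻¹' {y}) := by
  have hq : ∀ᶠ f : C(K, Fin n → ℝ) in residual C(K, Fin n → ℝ), ∀ q : ℚ,
      ((q : ℝ) : EReal) < dStar dim n (univ : Set K) → ∃ y, ((q : ℝ) : EReal) ≤ dim (f ⁻¹' {y}) :=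
    eventually_countable_forall.2 fun q => eventually_imp_distrib_left.2 (h q)
  filter_upwards [hq] with f hf
  refine le_of_forall_lt fun a ha => ?_
  obtain ⟨q, haq, hq⟩ := EReal.lt_iff_exists_rat_btwn.1 ha
  obtain ⟨y, hy⟩ := hf q hq
  exact haq.trans_le (hy.trans (le_iSup (fun y => dim (f ⁻¹' {y})) y))

theorem eventually_exists_le_of_pos [Nonempty K] {dim : Set K → EReal} {n : ℕ}
    (h0 : ∀ A : Set K, A.Nonempty → 0 ≤ dim A)
    (h : ∀ s : ℝ≥0, 0 < s → ((s : ℝ) : EReal) < dStar dim n (univ : Set K) →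
      ∀ᶠ f : C(K, Fin n → ℝ) in residual C(K, Fin n → ℝ), ∃ y, ((s : ℝ) : EReal) ≤ dim (f ⁻¹' {y}))
    (q : ℝ) (hq : (q : EReal) < dStar dim n (univ : Set K)) :
    ∀ᶠ f : C(K, Fin n → ℝ) in residual C(K, Fin n → ℝ), ∃ y, (q : EReal) ≤ dim (f ⁻¹' {y}) := by
  rcases le_or_gt q 0 with hq0 | hq0
  · obtain ⟨x⟩ := ‹Nonempty K›
    exact Eventually.of_forall fun f => ⟨f x, (EReal.coe_nonpos.2 hq0).trans (h0 _ ⟨x, rfl⟩)⟩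
  · lift q to ℝ≥0 using hq0.le
    exact h q (NNReal.coe_pos.1 hq0) hq

end GenericEquality

/-- For a generic `f ∈ C(K,ℝⁿ)`, `sup {dim_* f⁻¹(y) : y ∈ ℝⁿ} = d^n_*(K)`. -/
theorem stmt1 (n : ℕ) (hn : 0 < n) (K : Type*) [MetricSpace K] [CompactSpace K]
    (dimStar : Set K → EReal)
    (hdimStar : dimStar = tdim ∨ dimStar = hdim ∨ dimStar = pdim)
    (hK : (n : EReal) ≤ tdim (Set.univ : Set K)) :
    ∀ᶠ (f : C(K, Fin n → ℝ)) in residual C(K, Fin n → ℝ),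
      (⨆ y : Fin n → ℝ, dimStar (⇑f ⁻¹' {y})) = dStar dimStar n Set.univ := by
  have hdim : ¬ DimLT n (univ : Set K) := fun h => by
    have h1 : (((n : ℝ)) : EReal) ≤ (((n : ℝ) - 1 : ℝ) : EReal) := hK.trans (tdim_le_iff_dimLT.2 h)
    rw [EReal.coe_le_coe_iff] at h1
    linarith
  have : Nonempty K := by
    by_contra hne
    rw [not_nonempty_iff] at hne
    exact hdim ⟨fun _ => ∅, fun _ => .empty, (univ_eq_empty_iff.2 hne).subset.trans (empty_subset _)⟩
  rcases hdimStar with rfl | rfl | rfl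
  · filter_upwards [eventually_iSup_le_dStar hdim tdim_le_tdim_of_subset_union_finite,
      eventually_dStar_le_iSup fun q hq => eventually_exists_le_tdim_fibre hdim hq] with f h₁ h₂
    exact h₁.antisymm h₂
  · filter_upwards [eventually_iSup_le_dStar hdim hdim_le_hdim_of_subset_union_finite,
      eventually_dStar_le_iSup (eventually_exists_le_of_pos (fun _ => hdim_nonneg)
        fun _ => eventually_exists_le_hdim_fibre)] with f h₁ h₂
    exact h₁.antisymm h₂
  · filter_upwards [eventually_iSup_le_dStar hdim pdim_le_pdim_of_subset_union_finite,
      eventually_dStar_le_iSup (eventually_exists_le_of_pos (fun _ => pdim_nonneg)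
        fun _ => eventually_exists_le_pdim_fibre)] with f h₁ h₂
    exact h₁.antisymm h₂
end

section
/- If n is a positive integer and X is a separable metric space with dim_T X ≥ n, then d^n_T(X) = dim_T X − n (with the convention ∞ − n = ∞). -/
open Set Metric Filter Topology TopologicalSpace
open scoped ENNReal NNReal

universe u
theorem indBelow_zero_iff {Y : Type u} [TopologicalSpace Y] : indBelow 0 Y ↔ IsEmpty Y :=
  Iff.rfl

theorem indBelow_succ_iff {k : ℕ} {Y : Type u} [TopologicalSpace Y] :
    indBelow (k + 1) Y ↔ ∀ (x : Y) (U : Set Y), IsOpen U → x ∈ U →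
      ∃ V : Set Y, IsOpen V ∧ x ∈ V ∧ V ⊆ U ∧ indBelow k ↥(frontier V) :=
  Iff.rfl

theorem indBelow_of_isInducing {k : ℕ} {Y Z : Type u} [TopologicalSpace Y] [TopologicalSpace Z]
    {f : Y → Z} (hf : IsInducing f) (h : indBelow k Z) : indBelow k Y := by
  induction k generalizing Y Z with
  | zero => exact indBelow_zero_iff.2 ⟨fun y => (indBelow_zero_iff.1 h).false (f y)⟩
  | succ k ih =>
    intro x U hU hx
    obtain ⟨U', hU', rfl⟩ := hf.isOpen_iff.1 hU
    obtain ⟨V, hV, hxV, hVU, hk⟩ := indBelow_succ_iff.1 h (f x) U' hU' hx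
    have hsub : MapsTo f (frontier (f ⁻¹' V)) (frontier V) :=
      hf.continuous.frontier_preimage_subset V
    refine ⟨f ⁻¹' V, hV.preimage hf.continuous, hxV, preimage_mono hVU,
      ih (f := hsub.restrict f _ _) ?_ hk⟩
    exact IsInducing.of_comp (hf.continuous.restrict hsub) continuous_subtype_val
      (hf.comp IsInducing.subtypeVal)

theorem indBelow_mono_set {k : ℕ} {Y : Type u} [TopologicalSpace Y] {A B : Set Y} (hAB : A ⊆ B)
    (h : indBelow k ↥B) : indBelow k ↥A :=
  indBelow_of_isInducing (IsEmbedding.inclusion hAB).isInducing h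

theorem indBelow_image_val {k : ℕ} {Y : Type u} [TopologicalSpace Y] {A : Set Y} {s : Set ↥A} :
    indBelow k ↥(Subtype.val '' s) ↔ indBelow k ↥s :=
  let e := IsEmbedding.subtypeVal.homeomorphImage s
  ⟨indBelow_of_isInducing e.isInducing, indBelow_of_isInducing e.symm.isInducing⟩

theorem indBelow_succ {k : ℕ} {Y : Type u} [TopologicalSpace Y] (h : indBelow k Y) :
    indBelow (k + 1) Y := by
  induction k generalizing Y with
  | zero => exact fun x => ((indBelow_zero_iff.1 h).false x).elim
  | succ k ih =>
    intro x U hU hx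
    obtain ⟨V, hV, hxV, hVU, hk⟩ := indBelow_succ_iff.1 h x U hU hx
    exact ⟨V, hV, hxV, hVU, ih hk⟩

theorem indBelow_mono {k m : ℕ} (hkm : k ≤ m) {Y : Type u} [TopologicalSpace Y]
    (h : indBelow k Y) : indBelow m Y := by
  induction hkm with
  | refl => exact h
  | step _ ih => exact indBelow_succ ih

theorem indBelow_one_iff {Y : Type u} [TopologicalSpace Y] :
    indBelow 1 Y ↔ ∀ (x : Y) (U : Set Y), IsOpen U → x ∈ U → ∃ V, IsClopen V ∧ x ∈ V ∧ V ⊆ U := by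
  rw [indBelow_succ_iff]
  simp only [indBelow_zero_iff, isEmpty_coe_sort, ← isClopen_iff_frontier_eq_empty]
  exact ⟨fun h x U hU hx => let ⟨V, _, hxV, hVU, hc⟩ := h x U hU hx; ⟨V, hc, hxV, hVU⟩,
    fun h x U hU hx => let ⟨V, hc, hxV, hVU⟩ := h x U hU hx; ⟨V, hc.isOpen, hxV, hVU, hc⟩⟩

/-- In a Lindelöf zero-dimensional space disjoint closed sets are separated by a clopen set. -/
theorem exists_isClopen_separating {Y : Type u} [TopologicalSpace Y] [SecondCountableTopology Y]
    (h : indBelow 1 Y) {A B : Set Y} (hA : IsClosed A) (hB : IsClosed B) (hAB : Disjoint A B) :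
    ∃ W, IsClopen W ∧ A ⊆ W ∧ Disjoint W B := by
  have key : ∀ x : Y, ∃ V, IsClopen V ∧ x ∈ V ∧ (Disjoint V A ∨ Disjoint V B) := by
    intro x
    by_cases hx : x ∈ A
    · obtain ⟨V, hV, hxV, hVU⟩ := indBelow_one_iff.1 h x Bᶜ hB.isOpen_compl
        (disjoint_left.1 hAB hx)
      exact ⟨V, hV, hxV, .inr (disjoint_left.2 hVU)⟩
    · obtain ⟨V, hV, hxV, hVU⟩ := indBelow_one_iff.1 h x Aᶜ hA.isOpen_compl hx
      exact ⟨V, hV, hxV, .inl (disjoint_left.2 hVU)⟩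
  choose V hV hxV hVAB using key
  rcases isEmpty_or_nonempty Y with hY | hY
  · exact ⟨∅, isClopen_empty, fun x => (hY.false x).elim, empty_disjoint _⟩
  obtain ⟨t, htc, ht⟩ := TopologicalSpace.countable_cover_nhds fun x => (hV x).isOpen.mem_nhds (hxV x)
  have hne : t.Nonempty := by
    by_contra hne
    rw [not_nonempty_iff_eq_empty.1 hne, biUnion_empty] at ht
    exact empty_ne_univ ht
  obtain ⟨g, rfl⟩ := htc.exists_eq_range hne
  rw [biUnion_range] at ht
  let D : ℕ → Set Y := disjointed fun i => V (g i)
  have hDV (i : ℕ) : D i ⊆ V (g i) := disjointed_subset _ _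
  have hDU : ⋃ i, D i = univ := (iUnion_disjointed).trans ht
  have hDd : Pairwise (Function.onFun Disjoint D) := disjoint_disjointed _
  have hDo (i : ℕ) : IsOpen (D i) :=
    (disjointedRec (p := IsClopen) (fun _ _ ht => ht.diff (hV _)) (hV (g i))).isOpen
  let I : Set ℕ := {i | Disjoint (V (g i)) B}
  have hcompl : (⋃ i ∈ I, D i)ᶜ = ⋃ i ∈ Iᶜ, D i := by
    ext x
    obtain ⟨i, hi⟩ := mem_iUnion.1 (hDU.symm ▸ mem_univ x : x ∈ ⋃ i, D i)
    have huniq (j : ℕ) (hj : x ∈ D j) : j = i := by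
      by_contra hji
      exact disjoint_left.1 (hDd hji) hj hi
    simp only [mem_compl_iff, mem_iUnion, exists_prop, not_exists, not_and]
    constructor
    · exact fun hx => ⟨i, fun hI => hx i hI hi, hi⟩
    · rintro ⟨j, hj, hxj⟩ l hl hxl
      exact hj (huniq j hxj ▸ huniq l hxl ▸ hl)
  refine ⟨⋃ i ∈ I, D i, ⟨⟨?_⟩, isOpen_biUnion fun i _ => hDo i⟩, ?_, ?_⟩
  · rw [hcompl]
    exact isOpen_biUnion fun i _ => hDo i
  · intro x hx
    obtain ⟨i, hi⟩ := mem_iUnion.1 (hDU.symm ▸ mem_univ x : x ∈ ⋃ i, D i)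
    refine mem_biUnion (?_ : i ∈ I) hi
    exact (hVAB (g i)).resolve_left fun hd => disjoint_left.1 hd (hDV i hi) hx
  · exact disjoint_iUnion₂_left.2 fun i hi => Disjoint.mono_left (hDV i) hi

/-- A union of a set of dimension `≤ k - 1` and a zero-dimensional set has dimension `≤ k`. -/
theorem indBelow_union_one {k : ℕ} {X : Type u} [MetricSpace X] [SecondCountableTopology X]
    {Y Z : Set X} (hY : indBelow k ↥Y) (hZ : indBelow 1 ↥Z) : indBelow (k + 1) ↥(Y ∪ Z) := by
  rintro ⟨a, ha⟩ U₀ hU₀ hx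
  obtain ⟨U, hU, rfl⟩ := isOpen_induced_iff.1 hU₀
  replace hx : a ∈ U := hx
  obtain ⟨ε, hε, hεU⟩ := Metric.isOpen_iff.1 hU a hx
  let P : Set X := closedBall a (ε / 3)
  let Q : Set X := {y | 2 * ε / 3 ≤ dist y a}
  have hQ : IsClosed Q := isClosed_le continuous_const (continuous_id.dist continuous_const)
  have hPQ : Disjoint P Q := by
    refine disjoint_left.2 fun y (h1 : dist y a ≤ _) (h2 : _ ≤ dist y a) => ?_
    linarith
  obtain ⟨W, hW, hPW, hWQ⟩ := exists_isClopen_separating hZ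
    (isClosed_closedBall.preimage continuous_subtype_val : IsClosed ((↑) ⁻¹' P : Set Z))
    (hQ.preimage continuous_subtype_val) (hPQ.preimage _)
  let S : Set X := insert a ((↑) '' W)
  let T : Set X := Uᶜ ∪ (↑) '' Wᶜ
  have hST : Disjoint (closure S) T := by
    have hcl : closure S = insert a (closure ((↑) '' W)) := by
      simp only [S, insert_eq, closure_union, closure_singleton]
    rw [hcl, disjoint_union_right]
    constructor
    · refine disjoint_left.2 ?_
      rintro y (rfl | hy) hyU
      · exact hyU hx
      · have : closure ((↑) '' W) ⊆ {y | dist y a ≤ 2 * ε / 3} := by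
          refine closure_minimal ?_
            (isClosed_le (continuous_id.dist continuous_const) continuous_const)
          rintro _ ⟨w, hw, rfl⟩
          exact (not_le.1 fun hq : 2 * ε / 3 ≤ dist (w : X) a => disjoint_left.1 hWQ hw hq).le
        exact hyU (hεU (mem_ball.2 (lt_of_le_of_lt (this hy) (by linarith))))
    · refine disjoint_left.2 ?_
      rintro _ (hy | hy) ⟨w, hw, rfl⟩
      · refine hw (hPW ?_)
        change (w : X) ∈ P
        rw [hy]
        exact mem_closedBall_self (by positivity)
      · rw [← closure_subtype, hW.isClosed.closure_eq] at hy
        exact hw hy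
  have hTS : Disjoint S (closure T) := by
    rw [closure_union, hU.isClosed_compl.closure_eq, disjoint_union_right]
    have hS : S ⊆ closure S := subset_closure
    refine ⟨(hST.mono_left hS).mono_right subset_union_left, disjoint_left.2 ?_⟩
    rintro y (hya | ⟨w, hw, rfl⟩) hy
    · have : closure ((↑) '' Wᶜ) ⊆ {y | ε / 3 ≤ dist y a} := by
        refine closure_minimal ?_
          (isClosed_le continuous_const (continuous_id.dist continuous_const))
        rintro _ ⟨w, hw, rfl⟩
        exact (not_le.1 fun hq : dist (w : X) a ≤ ε / 3 => hw (hPW hq)).le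
      have := this hy
      simp only [hya, mem_ofPred_eq, dist_self] at this
      linarith
    · rw [← closure_subtype, hW.compl.isClosed.closure_eq] at hy
      exact hy hw
  obtain ⟨V, V', hV, hV', hSV, hTV', hVV'⟩ :=
    separatedNhds_iff_disjoint.2 (CompletelyNormalSpace.completely_normal hST hTS)
  have hcV : Disjoint (closure V) V' := hVV'.closure_left hV'
  have hfr : frontier V ∩ Z = ∅ := by
    refine eq_empty_of_forall_notMem fun z ⟨hz, hzZ⟩ => ?_
    rw [hV.frontier_eq] at hz
    by_cases hzW : (⟨z, hzZ⟩ : Z) ∈ W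
    · exact hz.2 (hSV (.inr ⟨_, hzW, rfl⟩))
    · exact disjoint_left.1 hcV hz.1 (hTV' (.inr ⟨_, hzW, rfl⟩))
  refine ⟨(↑) ⁻¹' V, hV.preimage continuous_subtype_val, hSV (mem_insert _ _), ?_, ?_⟩
  · intro y hy
    by_contra hyU
    exact disjoint_left.1 hVV' hy (hTV' (.inl hyU))
  · rw [← indBelow_image_val]
    refine indBelow_mono_set ?_ hY
    rintro _ ⟨y, hy, rfl⟩
    refine y.2.resolve_right fun hyZ => ?_
    exact hfr.subset ⟨continuous_subtype_val.frontier_preimage_subset V hy, hyZ⟩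

/-- Two disjoint closed sets can be enlarged to disjoint closed sets that also cover a given
closed zero-dimensional set. -/
theorem exists_closed_enlargement {X : Type u} [MetricSpace X] [SecondCountableTopology X]
    {F P Q : Set X} (hF : IsClosed F) (hF1 : indBelow 1 ↥F) (hP : IsClosed P) (hQ : IsClosed Q)
    (hPQ : Disjoint P Q) :
    ∃ P' Q' : Set X, IsClosed P' ∧ IsClosed Q' ∧ Disjoint P' Q' ∧ P ⊆ interior P' ∧
      Q ⊆ interior Q' ∧ F ⊆ P' ∪ Q' := by
  obtain ⟨W, hW, hPW, hWQ⟩ := exists_isClopen_separating hF1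
    (hP.preimage continuous_subtype_val) (hQ.preimage continuous_subtype_val) (hPQ.preimage _)
  have hP₁ : IsClosed (P ∪ (↑) '' W) := hP.union (hF.isClosedEmbedding_subtypeVal.isClosedMap _ hW.1)
  have hQ₁ : IsClosed (Q ∪ (↑) '' Wᶜ) :=
    hQ.union (hF.isClosedEmbedding_subtypeVal.isClosedMap _ hW.compl.1)
  have hd : P ∪ (↑) '' W ⊆ (Q ∪ (↑) '' Wᶜ)ᶜ := by
    rintro x (hx | ⟨w, hw, rfl⟩) (hx' | ⟨w', hw', hww⟩)
    · exact disjoint_left.1 hPQ hx hx'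
    · subst hww
      exact hw' (hPW hx)
    · exact disjoint_left.1 hWQ hw hx'
    · exact hw' (Subtype.ext hww ▸ hw)
  obtain ⟨u, hu, hPu, huQ⟩ := normal_exists_closure_subset hP₁ hQ₁.isOpen_compl hd
  obtain ⟨v, hv, hQv, hvu⟩ := normal_exists_closure_subset hQ₁ isClosed_closure.isOpen_compl
    (subset_compl_comm.1 huQ)
  have hui : u ⊆ interior (closure u) := hu.subset_interior_closure
  have hvi : v ⊆ interior (closure v) := hv.subset_interior_closure
  refine ⟨closure u, closure v, isClosed_closure, isClosed_closure,
    disjoint_right.2 hvu, subset_union_left.trans (hPu.trans hui),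
    subset_union_left.trans (hQv.trans hvi), fun x hx => ?_⟩
  by_cases hxW : (⟨x, hx⟩ : F) ∈ W
  · exact .inl (subset_closure (hPu (.inr ⟨_, hxW, rfl⟩)))
  · exact .inr (subset_closure (hQv (.inr ⟨_, hxW, rfl⟩)))

theorem indBelow_one_of_iUnion_eq_univ {X : Type u} [MetricSpace X] [SecondCountableTopology X]
    {C : ℕ → Set X} (hC : ∀ i, IsClosed (C i)) (hU : ⋃ i, C i = univ)
    (h : ∀ i, indBelow 1 ↥(C i)) : indBelow 1 X := by
  rw [indBelow_one_iff]
  intro x U hUo hx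
  let S := {p : Set X × Set X // IsClosed p.1 ∧ IsClosed p.2 ∧ Disjoint p.1 p.2}
  have hstep (i : ℕ) (p : S) : ∃ q : S, p.1.1 ⊆ interior q.1.1 ∧ p.1.2 ⊆ interior q.1.2 ∧
      C i ⊆ q.1.1 ∪ q.1.2 := by
    obtain ⟨P, Q, hP, hQ, hPQ, h1, h2, h3⟩ :=
      exists_closed_enlargement (hC i) (h i) p.2.1 p.2.2.1 p.2.2.2
    exact ⟨⟨(P, Q), hP, hQ, hPQ⟩, h1, h2, h3⟩
  choose step hstep₁ hstep₂ hstep₃ using hstep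
  let s : ℕ → S := fun n => Nat.rec
    ⟨({x}, Uᶜ), isClosed_singleton, hUo.isClosed_compl, by simpa using hx⟩ (fun n p => step n p) n
  have hP (n : ℕ) : (s n).1.1 ⊆ interior (s (n + 1)).1.1 := hstep₁ n (s n)
  have hQ (n : ℕ) : (s n).1.2 ⊆ interior (s (n + 1)).1.2 := hstep₂ n (s n)
  have hCs (n : ℕ) : C n ⊆ (s (n + 1)).1.1 ∪ (s (n + 1)).1.2 := hstep₃ n (s n)
  have hPm : Monotone fun n => (s n).1.1 :=
    monotone_nat_of_le_succ fun n => (hP n).trans interior_subset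
  have hQm : Monotone fun n => (s n).1.2 :=
    monotone_nat_of_le_succ fun n => (hQ n).trans interior_subset
  have hPo : IsOpen (⋃ n, (s n).1.1) := by
    refine isOpen_iff_mem_nhds.2 fun y hy => ?_
    obtain ⟨n, hn⟩ := mem_iUnion.1 hy
    exact mem_of_superset (mem_interior_iff_mem_nhds.1 (hP n hn))
      (subset_iUnion (fun n => (s n).1.1) (n + 1))
  have hQo : IsOpen (⋃ n, (s n).1.2) := by
    refine isOpen_iff_mem_nhds.2 fun y hy => ?_
    obtain ⟨n, hn⟩ := mem_iUnion.1 hy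
    exact mem_of_superset (mem_interior_iff_mem_nhds.1 (hQ n hn))
      (subset_iUnion (fun n => (s n).1.2) (n + 1))
  have hdis : Disjoint (⋃ n, (s n).1.1) (⋃ n, (s n).1.2) := by
    refine disjoint_iUnion_left.2 fun i => disjoint_iUnion_right.2 fun j => ?_
    exact ((s (max i j)).2.2.2.mono_left (hPm (le_max_left i j))).mono_right
      (hQm (le_max_right i j))
  have hcompl : (⋃ n, (s n).1.1)ᶜ = ⋃ n, (s n).1.2 := by
    refine subset_antisymm (fun y hy => ?_) (disjoint_left.1 hdis.symm)
    obtain ⟨n, hn⟩ := mem_iUnion.1 (hU.symm ▸ mem_univ y : y ∈ ⋃ i, C i)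
    exact mem_iUnion.2 ⟨n + 1, (hCs n hn).resolve_left fun h' => hy (mem_iUnion.2 ⟨n + 1, h'⟩)⟩
  refine ⟨⋃ n, (s n).1.1, ⟨⟨hcompl ▸ hQo⟩, hPo⟩, mem_iUnion.2 ⟨0, rfl⟩, fun y hy => ?_⟩
  by_contra hyU
  exact disjoint_left.1 hdis hy (mem_iUnion.2 ⟨0, hyU⟩)

theorem indBelow_one_of_subset_iUnion {X : Type u} [MetricSpace X] [SecondCountableTopology X]
    {A : Set X} {C : ℕ → Set X} (hC : ∀ i, IsClosed (C i)) (hA : A ⊆ ⋃ i, C i)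
    (h : ∀ i, indBelow 1 ↥(A ∩ C i)) : indBelow 1 ↥A := by
  refine indBelow_one_of_iUnion_eq_univ (C := fun i => ((↑) : A → X) ⁻¹' C i)
    (fun i => (hC i).preimage continuous_subtype_val) ?_ fun i => ?_
  · rw [← preimage_iUnion]
    exact eq_univ_of_forall fun x => hA x.2
  · rw [← indBelow_image_val, Subtype.image_preimage_coe]
    exact h i

theorem exists_decomposition_of_sum {k : ℕ} {X : Type u} [MetricSpace X]
    [SecondCountableTopology X]
    (hsum : ∀ (A : Set X) (C : ℕ → Set X), (∀ i, IsClosed (C i)) → A ⊆ ⋃ i, C i →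
      (∀ i, indBelow k ↥(A ∩ C i)) → indBelow k ↥A)
    {A : Set X} (h : indBelow (k + 1) ↥A) :
    ∃ C : ℕ → Set X, (∀ i, IsClosed (C i)) ∧ indBelow k ↥(A ∩ ⋃ i, C i) ∧
      indBelow 1 ↥(A \ ⋃ i, C i) := by
  have hb : IsTopologicalBasis {V : Set A | IsOpen V ∧ indBelow k ↥(frontier V)} := by
    refine isTopologicalBasis_of_isOpen_of_nhds (fun V hV => hV.1) fun x U hx hU => ?_
    obtain ⟨V, hV, hxV, hVU, hk⟩ := indBelow_succ_iff.1 h x U hU hx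
    exact ⟨V, ⟨hV, hk⟩, hxV, hVU⟩
  obtain ⟨s, hs, hsc, hsb⟩ := hb.exists_countable
  obtain ⟨g, hg⟩ := (hsc.insert ∅).exists_eq_range (insert_nonempty _ _)
  have hgk (i : ℕ) : indBelow k ↥(frontier (g i)) := by
    rcases (hg ▸ mem_range_self i : g i ∈ insert ∅ s) with h0 | hi
    · rw [h0, frontier_empty]
      exact indBelow_mono (Nat.zero_le k) (indBelow_zero_iff.2 inferInstance)
    · exact (hs hi).2
  choose C hC hCg using fun i => isClosed_induced_iff.1 (isClosed_frontier (s := g i))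
  refine ⟨C, hC, hsum _ C hC inter_subset_right fun i => ?_, ?_⟩
  · have := hgk i
    rw [← hCg, ← indBelow_image_val, Subtype.image_preimage_coe] at this
    exact indBelow_mono_set (inter_subset_inter_left _ inter_subset_left) this
  · rw [indBelow_one_iff]
    intro x U₀ hU₀ hx
    obtain ⟨U, hU, rfl⟩ := isOpen_induced_iff.1 hU₀
    let j : ↥(A \ ⋃ i, C i) → A := inclusion sdiff_subset
    have hj : Continuous j := continuous_inclusion sdiff_subset
    obtain ⟨V, hV, hxV, hVU⟩ := hsb.exists_subset_of_mem_open (a := j x)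
      (u := (↑) ⁻¹' U) hx (hU.preimage (continuous_subtype_val (p := (· ∈ A))))
    obtain ⟨i, rfl⟩ : V ∈ range g := hg ▸ mem_insert_of_mem _ hV
    refine ⟨j ⁻¹' g i, ?_, hxV, fun y hy => hVU hy⟩
    rw [isClopen_iff_frontier_eq_empty]
    refine eq_empty_of_forall_notMem fun y hy => y.2.2 (mem_iUnion.2 ⟨i, ?_⟩)
    have := hj.frontier_preimage_subset _ hy
    rw [← hCg] at this
    exact this

/-- The countable closed sum theorem. -/
theorem indBelow_of_subset_iUnion {k : ℕ} {X : Type u} [MetricSpace X]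
    [SecondCountableTopology X] {A : Set X} {C : ℕ → Set X} (hC : ∀ i, IsClosed (C i))
    (hA : A ⊆ ⋃ i, C i) (h : ∀ i, indBelow k ↥(A ∩ C i)) : indBelow k ↥A := by
  induction k generalizing A C with
  | zero =>
    refine indBelow_zero_iff.2 ⟨fun x => ?_⟩
    obtain ⟨i, hi⟩ := mem_iUnion.1 (hA x.2)
    exact (indBelow_zero_iff.1 (h i)).false ⟨x, x.2, hi⟩
  | succ k ih =>
    choose E hE hEk hE₁ using fun i =>
      exists_decomposition_of_sum (fun A C hC hA h => ih hC hA h) (h i)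
    let G : Set X := ⋃ i, C i ∩ ⋃ j, E i j
    have hY : indBelow k ↥(A ∩ G) := by
      refine ih (C := fun m => C m.unpair.1 ∩ E m.unpair.1 m.unpair.2)
        (fun m => (hC _).inter (hE _ _)) ?_ fun m => ?_
      · rintro x ⟨-, hx⟩
        obtain ⟨i, hi, hx⟩ := mem_iUnion.1 hx
        obtain ⟨j, hj⟩ := mem_iUnion.1 hx
        exact mem_iUnion.2 ⟨Nat.pair i j, by simpa using ⟨hi, hj⟩⟩
      · refine indBelow_mono_set ?_ (hEk m.unpair.1)
        exact fun x hx => ⟨⟨hx.1.1, hx.2.1⟩, mem_iUnion.2 ⟨_, hx.2.2⟩⟩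
    have hZ : indBelow 1 ↥(A \ G) := by
      refine indBelow_one_of_subset_iUnion hC (sdiff_subset.trans hA) fun i => ?_
      refine indBelow_mono_set ?_ (hE₁ i)
      exact fun x hx => ⟨⟨hx.1.1, hx.2⟩, fun hxE => hx.1.2 (mem_iUnion.2 ⟨i, hx.2, hxE⟩)⟩
    have := indBelow_union_one hY hZ
    rwa [inter_union_sdiff] at this

theorem exists_decomposition {k : ℕ} {X : Type u} [MetricSpace X] [SecondCountableTopology X]
    {A : Set X} (h : indBelow (k + 1) ↥A) :
    ∃ C : ℕ → Set X, (∀ i, IsClosed (C i)) ∧ indBelow k ↥(A ∩ ⋃ i, C i) ∧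
      indBelow 1 ↥(A \ ⋃ i, C i) :=
  exists_decomposition_of_sum (fun _ _ hC hA h => indBelow_of_subset_iUnion hC hA h) h

/-- The addition theorem (Urysohn inequality). -/
theorem indBelow_union {j k : ℕ} {X : Type u} [MetricSpace X] [SecondCountableTopology X]
    {A B : Set X} (hA : indBelow j ↥A) (hB : indBelow k ↥B) : indBelow (j + k) ↥(A ∪ B) := by
  induction j generalizing A with
  | zero =>
    rw [isEmpty_coe_sort.1 (indBelow_zero_iff.1 hA), empty_union, zero_add]
    exact hB
  | succ j ih =>
    obtain ⟨C, -, hY, hZ⟩ := exists_decomposition hA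
    have := indBelow_union_one (ih hY) hZ
    rwa [union_right_comm, inter_union_sdiff, add_right_comm] at this

theorem exists_fSigma_decomposition {j k : ℕ} {X : Type u} [MetricSpace X]
    [SecondCountableTopology X] (h : indBelow (j + k) ↥(univ : Set X)) :
    ∃ F : Set X, IsFSigmaIn F univ ∧ indBelow j ↥F ∧ indBelow k ↥(univ \ F) := by
  induction k generalizing j with
  | zero =>
    exact ⟨univ, ⟨fun _ => univ, fun _ => isClosed_univ, by simp [iUnion_const]⟩, h,
      indBelow_zero_iff.2 (by simp)⟩
  | succ k ih =>
    obtain ⟨F, ⟨D, hD, hFD⟩, hF, hFc⟩ := ih (j := j + 1) (by rwa [add_right_comm, add_assoc])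
    obtain ⟨C, hC, hY, hZ⟩ := exists_decomposition hF
    refine ⟨F ∩ ⋃ i, C i, ⟨fun m => D m.unpair.1 ∩ C m.unpair.2,
      fun m => (hD _).inter (hC _), ?_⟩, hY, ?_⟩
    · simp only [inter_univ] at hFD ⊢
      rw [hFD, iUnion_unpair fun i j => D i ∩ C j]
      simp only [iUnion_inter, inter_iUnion]
      exact iUnion_comm _
    · refine indBelow_mono_set (fun x hx => ?_) (indBelow_union_one hFc hZ)
      by_cases hxF : x ∈ F
      · exact .inr ⟨hxF, fun hxC => hx.2 ⟨hxF, hxC⟩⟩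
      · exact .inl ⟨trivial, hxF⟩

theorem natCast_sub_one_eq_coe (k : ℕ) : (k : EReal) - 1 = (((k : ℝ) - 1 : ℝ) : EReal) := by
  rw [EReal.coe_sub]
  rfl

theorem natCast_sub_one_add_natCast (k n : ℕ) :
    (k : EReal) - 1 + n = ((n + k : ℕ) : EReal) - 1 := by
  rw [natCast_sub_one_eq_coe, natCast_sub_one_eq_coe, ← EReal.coe_coe_eq_natCast n,
    ← EReal.coe_add]
  congr 1
  push_cast
  ring

theorem natCast_le_of_natCast_sub_one_lt {m k : ℕ} (h : (m : EReal) - 1 < k) : m ≤ k := by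
  rw [natCast_sub_one_eq_coe, ← EReal.coe_coe_eq_natCast k, EReal.coe_lt_coe_iff,
    sub_lt_iff_lt_add] at h
  exact Nat.lt_succ_iff.1 (by exact_mod_cast h)

theorem tdim_le_of_indBelow {k : ℕ} {X : Type u} [MetricSpace X] {A : Set X}
    (h : indBelow k ↥A) : tdim A ≤ (k : EReal) - 1 :=
  sInf_le ⟨k, h, rfl⟩

theorem indBelow_of_tdim_le {k : ℕ} {X : Type u} [MetricSpace X] {A : Set X}
    (h : tdim A ≤ (k : EReal) - 1) : indBelow k ↥A := by
  have hlt : tdim A < (k : EReal) := by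
    refine h.trans_lt ?_
    rw [natCast_sub_one_eq_coe, ← EReal.coe_coe_eq_natCast k, EReal.coe_lt_coe_iff]
    exact sub_one_lt _
  obtain ⟨_, ⟨m, hm, rfl⟩, hmk⟩ := sInf_lt_iff.1 hlt
  exact indBelow_mono (natCast_le_of_natCast_sub_one_lt hmk) hm

/-- If `dim_T X ≥ n` then `d^n_T(X) = dim_T X - n`. -/
theorem stmt2 (n : ℕ) (hn : 0 < n) (X : Type*) [MetricSpace X]
    [TopologicalSpace.SeparableSpace X]
    (hX : (n : EReal) ≤ tdim (Set.univ : Set X)) :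
    dStar tdim n (Set.univ : Set X) = tdim (Set.univ : Set X) - (n : EReal) := by
  have : SecondCountableTopology X := UniformSpace.secondCountable_of_separable X
  have hbot : (n : EReal) ≠ ⊥ := EReal.natCast_ne_bot n
  have htop : (n : EReal) ≠ ⊤ := EReal.natCast_ne_top n
  refine le_antisymm ?_ (le_sInf ?_)
  · rw [EReal.le_sub_iff_add_le (.inl hbot) (.inl htop)]
    refine le_sInf ?_
    rintro _ ⟨m, hm, rfl⟩
    have hnm : n ≤ m := by
      by_contra hmn
      have h1 : (n : EReal) ≤ (n : EReal) - 1 :=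
        hX.trans (tdim_le_of_indBelow (indBelow_mono (le_of_not_ge hmn) hm))
      rw [natCast_sub_one_eq_coe, ← EReal.coe_coe_eq_natCast n, EReal.coe_le_coe_iff] at h1
      linarith
    obtain ⟨k, rfl⟩ := Nat.exists_eq_add_of_le hnm
    obtain ⟨F, hFσ, hF, hFc⟩ := exists_fSigma_decomposition hm
    have hle : dStar tdim n (univ : Set X) ≤ tdim (univ \ F) :=
      sInf_le ⟨F, hFσ, tdim_le_of_indBelow hF, rfl⟩
    rw [← natCast_sub_one_add_natCast]
    exact add_le_add (hle.trans (tdim_le_of_indBelow hFc)) le_rfl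
  · rintro _ ⟨F, -, hF, rfl⟩
    refine le_sInf ?_
    rintro _ ⟨j, hj, rfl⟩
    have h := tdim_le_of_indBelow (indBelow_union (indBelow_of_tdim_le hF) hj)
    rwa [union_sdiff_cancel (subset_univ F), ← natCast_sub_one_add_natCast,
      ← EReal.sub_le_iff_le_add (.inl hbot) (.inl htop)] at h
end
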